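/- The Apéry-like series of weight 5 evaluates as: ∑_{k=1}^∞ 4^k H_k H_k^{(2)} / (k^2 · C(2k,k)) = −(155/8)ζ(5) + 9ζ(2)ζ(3) + 16 Li_5(1/2) + (19/2) ln(2) ζ(4) + (16/3) ln^3(2) ζ(2) − (2/15) ln^5(2). -/

import Mathlib

open Real

/-- Riemann zeta value at a positive integer `m > 1`, as the series `∑ 1/n^m`. -/
noncomputable def zetaVal (m : ℕ) : ℝ := ∑' n : ℕ, 1 / (n + 1 : ℝ) ^ m

/-- Polylogarithm `Li_m(z) = ∑_{k≥1} z^k / k^m`. -/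
noncomputable def polyLog (m : ℕ) (z : ℝ) : ℝ := ∑' k : ℕ, z ^ (k + 1) / (k + 1 : ℝ) ^ m

/-- Generalized harmonic number `H_k^{(m)} = ∑_{n=1}^k 1/n^m`. -/
noncomputable def genHarmonic (k m : ℕ) : ℝ := ∑ n ∈ Finset.range k, 1 / (n + 1 : ℝ) ^ m

namespace Apery
open Finset Filter Topology

/-- half-odd numbers `n + 1/2` -/
noncomputable def hd (n : ℕ) : ℝ := (n : ℝ) + 1 / 2

lemma hd_pos (n : ℕ) : 0 < hd n := by unfold hd; positivity

lemma hd_succ (n : ℕ) : hd (n + 1) = hd n + 1 := by unfold hd; push_cast; ring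

/-- the Beta value `B(k+1, n+1/2)` -/
noncomputable def bet (k n : ℕ) : ℝ := (1 / hd n) * ∏ j ∈ range k, (((j : ℝ) + 1) / ((j : ℝ) + 1 + hd n))

lemma bet_pos (k n : ℕ) : 0 < bet k n := by
  unfold bet
  have := hd_pos n
  apply mul_pos (by positivity)
  apply prod_pos
  intro j _
  positivity

lemma bet_zero (n : ℕ) : bet 0 n = 1 / hd n := by simp [bet]

lemma bet_succ_left (k n : ℕ) : bet (k + 1) n = bet k n * (((k : ℝ) + 1) / ((k : ℝ) + 1 + hd n)) := by
  unfold bet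
  rw [prod_range_succ]; ring

lemma bet_succ_right (k n : ℕ) : bet k (n + 1) = bet k n * (hd n / ((k : ℝ) + 1 + hd n)) := by
  have h := hd_pos n
  induction k with
  | zero =>
    rw [bet_zero, bet_zero, hd_succ]
    push_cast
    field_simp
    ring
  | succ k ih =>
    rw [bet_succ_left, bet_succ_left, ih, hd_succ]
    push_cast
    have : (k : ℝ) + 1 + hd n ≠ 0 := by positivity
    have : (k : ℝ) + 1 + (hd n + 1) ≠ 0 := by positivity
    have : (k : ℝ) + 1 + 1 + hd n ≠ 0 := by positivity
    field_simp
    ring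

lemma bet_tele1 (k n : ℕ) : bet k n - bet (k + 1) n = bet k (n + 1) := by
  rw [bet_succ_left, bet_succ_right]
  have h := hd_pos n
  have : (k : ℝ) + 1 + hd n ≠ 0 := by positivity
  field_simp
  ring

lemma bet_tele2 (k n : ℕ) : (bet k n - bet k (n + 1)) / ((k : ℝ) + 1) = bet k (n + 1) / hd n := by
  rw [bet_succ_right]
  have h := hd_pos n
  have : (k : ℝ) + 1 + hd n ≠ 0 := by positivity
  have : (k : ℝ) + 1 ≠ 0 := by positivity
  field_simp
  ring

lemma bet_tele3 (k n : ℕ) : bet (k + 1) n / ((k : ℝ) + 1) = bet k (n + 1) / hd n := by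
  rw [bet_succ_right, bet_succ_left]
  have h := hd_pos n
  have : (k : ℝ) + 1 + hd n ≠ 0 := by positivity
  have : (k : ℝ) + 1 ≠ 0 := by positivity
  field_simp

lemma bet_anti_right (k n : ℕ) : bet k (n + 1) ≤ bet k n := by
  have := bet_tele1 k n
  have h2 := bet_tele2 k n
  have h3 := bet_pos k (n+1)
  have h4 := hd_pos n
  have : 0 ≤ (bet k n - bet k (n + 1)) / ((k : ℝ) + 1) := by rw [h2]; positivity
  have h5 : (0:ℝ) < (k:ℝ) + 1 := by positivity
  rw [le_div_iff₀ h5] at this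
  linarith

lemma bet_le_zero (k n : ℕ) : bet k n ≤ bet k 0 := by
  induction n with
  | zero => exact le_rfl
  | succ n ih => exact (bet_anti_right k n).trans ih

lemma bet_le_inv (k n : ℕ) : bet k n ≤ 1 / hd n := by
  induction k with
  | zero => rw [bet_zero]
  | succ k ih =>
    have := bet_tele1 k n
    have h3 := bet_pos k (n+1)
    linarith

lemma bet_sq (k : ℕ) : bet k 0 ^ 2 * ((k : ℝ) + 1) ≤ 4 := by
  induction k with
  | zero => rw [bet_zero]; norm_num [hd]
  | succ k ih =>
    rw [bet_succ_left]
    refine le_trans ?_ ih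
    have hb := bet_pos k 0
    have : ((k : ℝ) + 1) / ((k : ℝ) + 1 + hd 0) = ((k : ℝ) + 1) / ((k : ℝ) + 1 + 1/2) := by simp [hd]
    rw [this, mul_pow, mul_assoc]
    apply mul_le_mul_of_nonneg_left _ (by positivity)
    rw [div_pow, div_mul_eq_mul_div, div_le_iff₀ (by positivity)]
    push_cast
    have : (0:ℝ) ≤ k := by positivity
    nlinarith

/-- elementary symmetric functions of `1, 1/2, ..., 1/k` -/
noncomputable def es : ℕ → ℕ → ℝ
  | 0, _ => 1
  | j + 1, k => ∑ i ∈ range k, es j i / ((i : ℝ) + 1)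

lemma es_zero (k : ℕ) : es 0 k = 1 := by simp [es]

lemma es_succ_zero (j : ℕ) : es (j + 1) 0 = 0 := by simp [es]

lemma es_succ_succ (j k : ℕ) : es (j + 1) (k + 1) = es (j + 1) k + es j k / ((k : ℝ) + 1) := by
  simp only [es]
  rw [sum_range_succ]

lemma es_nonneg (j k : ℕ) : 0 ≤ es j k := by
  induction j generalizing k with
  | zero => simp [es]
  | succ j ih =>
    simp only [es]
    apply sum_nonneg
    intro i _
    have := ih i
    positivity

lemma harm_eq (k : ℕ) : ((harmonic k : ℚ) : ℝ) = ∑ i ∈ range k, 1 / ((i : ℝ) + 1) := by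
  simp [harmonic]

lemma es_le (j k : ℕ) : es j k ≤ (∑ i ∈ range k, 1 / ((i : ℝ) + 1)) ^ j := by
  induction j generalizing k with
  | zero => simp [es]
  | succ j ih =>
    simp only [es]
    rw [pow_succ, mul_sum]
    apply sum_le_sum
    intro i hi
    rw [mem_range] at hi
    rw [div_eq_mul_one_div]
    apply mul_le_mul_of_nonneg_right _ (by positivity)
    refine (ih i).trans ?_
    apply pow_le_pow_left₀ (sum_nonneg fun _ _ => by positivity)
    apply sum_le_sum_of_subset_of_nonneg
    · intro x; simp only [mem_range]; omega
    · intros; positivity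

lemma harm_le (k : ℕ) : ∑ i ∈ range k, 1 / ((i : ℝ) + 1) ≤ Real.log (Real.exp 1 * ((k : ℝ) + 1)) := by
  rw [← harm_eq]
  refine (harmonic_le_one_add_log k).trans ?_
  rw [Real.log_mul (Real.exp_ne_zero _) (by positivity), Real.log_exp]
  rcases Nat.eq_zero_or_pos k with h | h
  · subst h; simp
  · have : Real.log k ≤ Real.log (k+1) := by
      apply Real.log_le_log (by exact_mod_cast h); linarith
    linarith

lemma tend_log (j : ℕ) : Tendsto (fun k : ℕ => Real.log (Real.exp 1 * ((k : ℝ) + 1)) ^ j / ((k : ℝ) + 1)) atTop (𝓝 0) := by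
  have h := (isLittleO_pow_log_id_atTop (n := j)).tendsto_div_nhds_zero
  have h2 : Tendsto (fun k : ℕ => Real.exp 1 * ((k : ℝ) + 1)) atTop atTop := by
    apply Tendsto.const_mul_atTop (Real.exp_pos 1)
    exact tendsto_atTop_add_const_right _ _ tendsto_natCast_atTop_atTop
  have h3 := (h.comp h2).const_mul (Real.exp 1)
  rw [mul_zero] at h3
  refine h3.congr fun k => ?_
  simp only [Function.comp, id]
  have := Real.exp_pos 1
  field_simp

lemma tend_bet_es (n j : ℕ) : Tendsto (fun k : ℕ => bet k n * es j k) atTop (𝓝 0) := by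
  have h := (tend_log (2 * j)).const_mul 4
  rw [mul_zero] at h
  have h2 : Tendsto (fun k : ℕ => (bet k n * es j k) ^ 2) atTop (𝓝 0) := by
    refine squeeze_zero (fun k => sq_nonneg _) (fun k => ?_) h
    have a1 := bet_sq k
    have a2 := bet_le_zero k n
    have a3 := bet_pos k n
    have a4 := (es_le j k).trans (pow_le_pow_left₀ (sum_nonneg fun _ _ => by positivity) (harm_le k) j)
    have a5 := es_nonneg j k
    rw [mul_pow, ← mul_div_assoc, le_div_iff₀ (by positivity)]
    calc bet k n ^ 2 * es j k ^ 2 * ((k : ℝ) + 1) = (bet k n ^ 2 * ((k : ℝ) + 1)) * es j k ^ 2 := by ring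
      _ ≤ (bet k 0 ^ 2 * ((k : ℝ) + 1)) * (Real.log (Real.exp 1 * ((k : ℝ) + 1)) ^ j) ^ 2 := by gcongr
      _ ≤ 4 * (Real.log (Real.exp 1 * ((k : ℝ) + 1)) ^ j) ^ 2 := by gcongr
      _ = _ := by rw [← pow_mul]; ring
  have h3 := h2.sqrt
  simp only [Real.sqrt_zero] at h3
  refine h3.congr fun k => ?_
  rw [Real.sqrt_sq (mul_nonneg (bet_pos _ _).le (es_nonneg _ _))]

lemma bet_es_sum (n j : ℕ) : HasSum (fun k : ℕ => bet k (n + 1) * es j k) (1 / hd n ^ (j + 1)) := by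
  have hn := hd_pos n
  induction j with
  | zero =>
    rw [hasSum_iff_tendsto_nat_of_nonneg (fun k => mul_nonneg (bet_pos _ _).le (es_nonneg _ _))]
    have h := (tend_bet_es n 0).const_sub (1 / hd n)
    rw [sub_zero] at h
    rw [zero_add, pow_one]
    refine h.congr fun N => ?_
    simp only [es_zero, mul_one]
    induction N with
    | zero => simp [bet_zero]
    | succ N ih => rw [sum_range_succ, ← ih, ← bet_tele1]; ring
  | succ j ih =>
    rw [hasSum_iff_tendsto_nat_of_nonneg (fun k => mul_nonneg (bet_pos _ _).le (es_nonneg _ _))]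
    have h := (ih.tendsto_sum_nat.const_mul (1 / hd n)).sub (tend_bet_es n (j+1))
    rw [sub_zero] at h
    have e : 1 / hd n * (1 / hd n ^ (j + 1)) = 1 / hd n ^ (j + 1 + 1) := by
      rw [pow_succ _ (j+1)]; field_simp
    rw [e] at h
    refine h.congr fun N => ?_
    induction N with
    | zero => simp [es_succ_zero]
    | succ N ih2 =>
      rw [sum_range_succ, sum_range_succ, ← ih2, es_succ_succ]
      have t1 := bet_tele1 N n
      have t3 := bet_tele3 N n
      have : bet (N+1) n * (es j N / ((N:ℝ)+1)) = bet N (n+1) / hd n * es j N := by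
        rw [← t3]; ring
      rw [mul_add (bet (N + 1) n), this, ← t1]; ring

/-- sums of `1/(i+1/2)` -/
noncomputable def PP (m : ℕ) : ℝ := ∑ i ∈ range m, 1 / hd i

lemma PP_succ (m : ℕ) : PP (m + 1) = PP m + 1 / hd m := by
  unfold PP; rw [sum_range_succ]

lemma PP_nonneg (m : ℕ) : 0 ≤ PP m := by
  unfold PP; apply sum_nonneg; intro i _; have := hd_pos i; positivity

lemma PP_le (m : ℕ) : PP m ≤ 2 * Real.log (Real.exp 1 * ((m : ℝ) + 1)) := by
  refine le_trans ?_ (mul_le_mul_of_nonneg_left (harm_le m) (by norm_num))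
  unfold PP
  rw [mul_sum]
  apply sum_le_sum
  intro i _
  rw [mul_one_div, div_le_div_iff₀ (hd_pos i) (by positivity)]
  unfold hd
  have : (0:ℝ) ≤ i := by positivity
  linarith

lemma inv_hd_le (m : ℕ) : 1 / hd m ≤ 2 / ((m : ℝ) + 1) := by
  rw [div_le_div_iff₀ (hd_pos m) (by positivity)]
  unfold hd
  have : (0:ℝ) ≤ m := by positivity
  linarith

lemma tend_bet_right (k : ℕ) : Tendsto (fun m : ℕ => bet k m) atTop (𝓝 0) := by
  refine squeeze_zero (fun m => (bet_pos k m).le) (fun m => (bet_le_inv k m).trans (inv_hd_le m)) ?_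
  have := (tend_log 0).const_mul 2
  simpa [div_eq_mul_inv] using this

lemma tend_bet_PP (k : ℕ) : Tendsto (fun m : ℕ => bet k m * PP m) atTop (𝓝 0) := by
  have h := (tend_log 1).const_mul 4
  rw [mul_zero] at h
  refine squeeze_zero (fun m => mul_nonneg (bet_pos k m).le (PP_nonneg m)) (fun m => ?_) h
  have a := (bet_le_inv k m).trans (inv_hd_le m)
  calc bet k m * PP m ≤ (2 / ((m : ℝ) + 1)) * (2 * Real.log (Real.exp 1 * ((m : ℝ) + 1))) :=
        mul_le_mul a (PP_le m) (PP_nonneg m) (by positivity)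
    _ = _ := by rw [pow_one]; ring

lemma bet_right_sum1 (k : ℕ) : HasSum (fun m : ℕ => bet k (m + 1) / hd m) (bet k 0 / ((k : ℝ) + 1)) := by
  rw [hasSum_iff_tendsto_nat_of_nonneg (fun m => div_nonneg (bet_pos _ _).le (hd_pos _).le)]
  have h := ((tend_bet_right k).const_sub (bet k 0)).div_const ((k : ℝ) + 1)
  rw [sub_zero] at h
  refine h.congr fun N => ?_
  induction N with
  | zero => simp
  | succ N ih => rw [sum_range_succ, ← ih, ← bet_tele2]; ring

lemma bet_right_sum2 (k : ℕ) :
    HasSum (fun m : ℕ => bet k (m + 1) / hd m * PP m) (bet k 0 / ((k : ℝ) + 1) ^ 2) := by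
  rw [hasSum_iff_tendsto_nat_of_nonneg
    (fun m => mul_nonneg (div_nonneg (bet_pos _ _).le (hd_pos _).le) (PP_nonneg m))]
  have h := ((bet_right_sum1 k).tendsto_sum_nat.sub (tend_bet_PP k)).div_const ((k : ℝ) + 1)
  rw [sub_zero] at h
  have e : bet k 0 / ((k : ℝ) + 1) / ((k : ℝ) + 1) = bet k 0 / ((k : ℝ) + 1) ^ 2 := by
    rw [div_div, sq]
  rw [e] at h
  refine h.congr fun N => ?_
  induction N with
  | zero => simp [PP]
  | succ N ih =>
    rw [sum_range_succ, sum_range_succ, ← ih, PP_succ]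
    have t2 := bet_tele2 k N
    rw [← t2]
    have : bet k (N+1) * (1 / hd N) = (bet k N - bet k (N + 1)) / ((k : ℝ) + 1) := by rw [t2]; ring
    rw [mul_add, this]
    ring

lemma swap_sum {f : ℕ → ℕ → ℝ} (hf : ∀ i j, 0 ≤ f i j) {g h : ℕ → ℝ} {s : ℝ}
    (h1 : ∀ i, HasSum (fun j => f i j) (g i)) (h2 : ∀ j, HasSum (fun i => f i j) (h j))
    (h3 : HasSum h s) : HasSum g s := by
  have hs : Summable (fun p : ℕ × ℕ => f p.2 p.1) := by
    rw [summable_prod_of_nonneg (fun p => hf _ _)]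
    refine ⟨fun j => (h2 j).summable, ?_⟩
    refine h3.summable.congr fun j => ?_
    exact (h2 j).tsum_eq.symm
  obtain ⟨t, ht⟩ := hs
  have e := ht.prod_fiberwise h2
  have : t = s := e.unique h3
  subst this
  have ht' : HasSum (fun p : ℕ × ℕ => f p.1 p.2) t := by
    have := (Equiv.prodComm ℕ ℕ).hasSum_iff (f := fun p : ℕ × ℕ => f p.2 p.1) (a := t)
    exact this.2 ht
  exact ht'.prod_fiberwise h1

lemma sum_Y {Y : ℝ} (hY : HasSum (fun m : ℕ => PP m / hd m ^ 4 + 1 / hd m ^ 5) Y) :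
    HasSum (fun k : ℕ => bet k 0 / ((k : ℝ) + 1) * es 3 (k + 1)) Y := by
  refine swap_sum (f := fun k m => bet k (m + 1) / hd m * es 3 k + bet k (m + 1) / hd m * PP m * es 2 k)
    ?_ ?_ ?_ hY
  · intro k m
    have := bet_pos k (m+1)
    have := hd_pos m
    have := es_nonneg 3 k
    have := es_nonneg 2 k
    have := PP_nonneg m
    positivity
  · intro k
    have := ((bet_right_sum1 k).mul_right (es 3 k)).add ((bet_right_sum2 k).mul_right (es 2 k))
    have e : bet k 0 / ((k : ℝ) + 1) * es 3 (k + 1) =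
        bet k 0 / ((k : ℝ) + 1) * es 3 k + bet k 0 / ((k : ℝ) + 1) ^ 2 * es 2 k := by
      rw [es_succ_succ]
      field_simp
    rw [e]
    exact this
  · intro m
    have := ((bet_es_sum m 3).mul_right (1 / hd m)).add ((bet_es_sum m 2).mul_right (1 / hd m * PP m))
    have hm := hd_pos m
    have e : PP m / hd m ^ 4 + 1 / hd m ^ 5 =
        1 / hd m ^ (3 + 1) * (1 / hd m) + 1 / hd m ^ (2 + 1) * (1 / hd m * PP m) := by
      field_simp
      ring
    rw [e]
    refine this.congr_fun fun k => ?_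
    ring

end Apery
namespace Apery
open Finset Filter Topology

lemma zeta_hasSum {s : ℕ} (hs : 2 ≤ s) : HasSum (fun n : ℕ => 1 / ((n : ℝ) + 1) ^ s) (zetaVal s) := by
  have h : Summable (fun n : ℕ => 1 / ((n : ℝ)) ^ s) := Real.summable_one_div_nat_pow.2 (by omega)
  have h2 := (summable_nat_add_iff 1).2 h
  have h3 : Summable (fun n : ℕ => 1 / ((n : ℝ) + 1) ^ s) := by
    refine h2.congr fun n => ?_
    push_cast; rfl
  exact h3.hasSum

lemma T_hasSum {s : ℕ} (hs : 2 ≤ s) :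
    HasSum (fun n : ℕ => 1 / hd n ^ s) (((2 : ℝ) ^ s - 1) * zetaVal s) := by
  have hz := zeta_hasSum hs
  have hodd : HasSum (fun k : ℕ => 1 / (((2 * k + 1 : ℕ) : ℝ) + 1) ^ s) ((1 / 2 ^ s) * zetaVal s) := by
    refine (hz.mul_left (1 / 2 ^ s)).congr_fun fun k => ?_
    push_cast
    rw [one_div_mul_one_div, ← mul_pow]
    ring_nf
  have hev : Summable (fun k : ℕ => 1 / (((2 * k : ℕ) : ℝ) + 1) ^ s) :=
    hz.summable.comp_injective (i := fun k : ℕ => 2 * k) (fun a b h => by simpa using h)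
  obtain ⟨t, ht⟩ := hev
  have h := HasSum.even_add_odd (f := fun n : ℕ => 1 / ((n : ℝ) + 1) ^ s) ht hodd
  have e := h.unique hz
  have ht2 := ht.mul_left ((2:ℝ) ^ s)
  have : (2:ℝ) ^ s * t = ((2 : ℝ) ^ s - 1) * zetaVal s := by
    have : t = zetaVal s - (1 / 2 ^ s) * zetaVal s := by linarith
    rw [this]; field_simp
  rw [this] at ht2
  refine ht2.congr_fun fun k => ?_
  unfold hd
  have h2 : ((k : ℝ) + 1 / 2) = (((2 * k : ℕ) : ℝ) + 1) / 2 := by push_cast; ring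
  rw [h2, div_pow]
  field_simp

lemma PP_eq (N : ℕ) : PP N = 2 * ((harmonic (2 * N) : ℚ) : ℝ) - ((harmonic N : ℚ) : ℝ) := by
  induction N with
  | zero => simp [PP]
  | succ N ih =>
    rw [PP_succ, ih, show 2 * (N + 1) = (2 * N + 1) + 1 by ring, harmonic_succ, harmonic_succ, harmonic_succ]
    unfold hd
    push_cast
    field_simp
    ring

lemma tend_H_PP : Tendsto (fun N : ℕ => ((harmonic N : ℚ) : ℝ) - PP N) atTop (𝓝 (-(2 * Real.log 2))) := by
  have h1 := Real.tendsto_harmonic_sub_log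
  have h2 : Tendsto (fun N : ℕ => ((harmonic (2 * N) : ℚ) : ℝ) - Real.log ((2 * N : ℕ) : ℝ)) atTop
      (𝓝 Real.eulerMascheroniConstant) :=
    h1.comp (tendsto_id.const_mul_atTop' (by norm_num : 0 < 2))
  have h3 := ((h1.sub h2).sub_const (Real.log 2)).const_mul 2
  rw [sub_self, zero_sub, mul_neg] at h3
  refine h3.congr' ?_
  filter_upwards [eventually_gt_atTop 0] with N hN
  have : (N : ℝ) ≠ 0 := by positivity
  push_cast
  rw [PP_eq, Real.log_mul (by norm_num) this]
  ring

lemma tend_inv_lin (c : ℝ) : Tendsto (fun N : ℕ => 1 / ((N : ℝ) + c)) atTop (𝓝 0) := by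
  have : Tendsto (fun N : ℕ => (N : ℝ) + c) atTop atTop :=
    tendsto_atTop_add_const_right _ _ tendsto_natCast_atTop_atTop
  refine this.inv_tendsto_atTop.congr fun N => ?_
  simp

lemma tend_D (k : ℕ) :
    Tendsto (fun N : ℕ => ∑ n ∈ range N, (1 / (hd n - k) - 1 / (hd n + k))) atTop (𝓝 0) := by
  induction k with
  | zero => simp
  | succ k ih =>
    have h := (ih.sub (tend_inv_lin (-1/2 - k))).sub (tend_inv_lin (1/2 + k))
    rw [sub_zero, sub_zero] at h
    refine h.congr fun N => ?_
    induction N with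
    | zero =>
      simp
      have : (-1 / 2 - (k:ℝ)) = - (2⁻¹ + k) := by ring
      rw [this, inv_neg]; ring
    | succ N ih2 =>
      rw [sum_range_succ, sum_range_succ, ← ih2]
      generalize (∑ n ∈ range N, (1 / (hd n - (k:ℝ)) - 1 / (hd n + (k:ℝ)))) = Z
      unfold hd
      push_cast
      ring_nf

lemma tend_C (n : ℕ) :
    Tendsto (fun N : ℕ => ∑ k ∈ range N, (1 / ((k : ℝ) + 1) +
      1 / 2 * (1 / (hd n - (k + 1)) - 1 / (hd n + (k + 1))))) atTop
      (𝓝 (PP n + 1 / (2 * hd n) - 2 * Real.log 2)) := by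
  induction n with
  | zero =>
    have h := (tend_H_PP.sub ((tend_inv_lin (1/2)).const_mul (1/2))).add_const 1
    have e : -(2 * Real.log 2) - 1 / 2 * 0 + 1 = PP 0 + 1 / (2 * hd 0) - 2 * Real.log 2 := by
      simp [PP, hd]; ring
    rw [e] at h
    refine h.congr fun N => ?_
    induction N with
    | zero => simp [PP]
    | succ N ih2 =>
      rw [sum_range_succ, ← ih2, harmonic_succ, PP_succ]
      unfold hd
      push_cast
      have : (0:ℝ) + 1 / 2 - (N + 1) = -(N + 1/2) := by ring
      rw [this, one_div_neg_eq_neg_one_div]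
      ring_nf
  | succ n ih =>
    have h := ih.add ((((tend_inv_lin (- hd n)).const_add (1 / hd n)).add
      ((tend_inv_lin (hd n + 1)).const_sub (1 / (hd n + 1)))).const_mul (1 / 2))
    have hp := hd_pos n
    have e : PP n + 1 / (2 * hd n) - 2 * Real.log 2 + 1 / 2 * (1 / hd n + 0 + (1 / (hd n + 1) - 0)) =
        PP (n + 1) + 1 / (2 * hd (n + 1)) - 2 * Real.log 2 := by
      rw [PP_succ, hd_succ]; field_simp; ring
    rw [e] at h
    refine h.congr fun N => ?_
    induction N with
    | zero => 
      simp
    | succ N ih2 =>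
      rw [sum_range_succ, sum_range_succ, ← ih2, hd_succ]
      generalize (∑ k ∈ range N, (1 / ((k : ℝ) + 1) + 1 / 2 * (1 / (hd n - ((k : ℝ) + 1)) - 1 / (hd n + ((k : ℝ) + 1))))) = Z
      push_cast
      have e1 : (N : ℝ) + 1 + -hd n = -(hd n - (N + 1)) := by ring
      have e2 : (N : ℝ) + -hd n = -(hd n + 1 - (N + 1)) := by ring
      rw [e1, e2, one_div_neg_eq_neg_one_div, one_div_neg_eq_neg_one_div]
      ring_nf

lemma hd_ne (n k : ℕ) : hd n - k ≠ 0 := by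
  unfold hd
  intro h
  have h2 : ((2 * n + 1 : ℕ) : ℝ) = ((2 * k : ℕ) : ℝ) := by push_cast; linarith
  have h3 : 2 * n + 1 = 2 * k := by exact_mod_cast h2
  omega

lemma hd_sq_ne (n k : ℕ) : hd n ^ 2 - ((k : ℝ) + 1) ^ 2 ≠ 0 := by
  have h1 := hd_ne n (k + 1)
  push_cast at h1
  have h2 := hd_pos n
  rw [sq_sub_sq]
  exact mul_ne_zero (by positivity) h1

lemma hd_abs (n k : ℕ) : 1 / 2 ≤ |hd n - k| := by
  unfold hd
  have h : (1:ℝ) ≤ |((2 * (n:ℤ) + 1 - 2 * k : ℤ) : ℝ)| := by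
    have : (1:ℤ) ≤ |2 * (n:ℤ) + 1 - 2 * k| := Int.one_le_abs (by omega)
    exact_mod_cast this
  push_cast at h
  have e : (2 * (n:ℝ) + 1 - 2 * k) = 2 * (n + 1 / 2 - k) := by ring
  rw [e, abs_mul, abs_two] at h
  linarith

lemma bound_F1 (k n : ℕ) :
    ‖1 / (((k : ℝ) + 1) ^ 3 * (hd n ^ 2 - ((k : ℝ) + 1) ^ 2))‖ ≤
      8 * (1 / ((k : ℝ) + 1) ^ 2 * (1 / hd n ^ 2)) := by
  have h1 := hd_abs n (k + 1)
  push_cast at h1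
  have he := hd_pos n
  set e := hd n
  have hx : (1:ℝ) ≤ (k:ℝ) + 1 := by have : (0:ℝ) ≤ k := by positivity
                                    linarith
  set x := (k : ℝ) + 1
  have hx0 : 0 < x := by linarith
  rw [norm_div, norm_mul, norm_pow, norm_one, Real.norm_of_nonneg hx0.le, Real.norm_eq_abs, sq_sub_sq, abs_mul,
    abs_of_pos (by positivity : 0 < e + x)]
  have key : x ^ 2 * e ^ 2 ≤ 8 * (x ^ 3 * ((e + x) * |e - x|)) := by
    rcases le_total (2 * x) e with h | h
    · rw [abs_of_nonneg (by linarith)]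
      have : e ^ 2 ≤ 8 * (x * ((e + x) * (e - x))) := by
        have : e ^ 2 ≤ 8 * ((e + x) * (e - x)) := by nlinarith
        have h3 : (e + x) * (e - x) ≤ x * ((e + x) * (e - x)) := by
          apply le_mul_of_one_le_left _ hx
          apply mul_nonneg <;> linarith
        linarith
      calc x ^ 2 * e ^ 2 ≤ x ^ 2 * (8 * (x * ((e + x) * (e - x)))) := by gcongr
        _ = _ := by ring
    · have : e ^ 2 ≤ 8 * (x * ((e + x) * (1/2))) := by nlinarith
      calc x ^ 2 * e ^ 2 ≤ x ^ 2 * (8 * (x * ((e + x) * (1/2)))) := by gcongr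
        _ ≤ x ^ 2 * (8 * (x * ((e + x) * |e - x|))) := by gcongr
        _ = _ := by ring
  have hpos : 0 < |e - x| := by linarith
  rw [one_div_mul_one_div, mul_one_div, div_le_div_iff₀ (by positivity) (by positivity)]
  linarith

set_option maxHeartbeats 1000000 in
lemma Y_hasSum : HasSum (fun m : ℕ => PP m / hd m ^ 4 + 1 / hd m ^ 5)
    (30 * Real.log 2 * zetaVal 4 + 31 / 2 * zetaVal 5 - 3 * zetaVal 2 * zetaVal 3) := by
  have hT2 := T_hasSum (s := 2) (by norm_num)
  have hT4 := T_hasSum (s := 4) (by norm_num)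
  have hT5 := T_hasSum (s := 5) (by norm_num)
  have hz2 := zeta_hasSum (s := 2) (by norm_num)
  have hz3 := zeta_hasSum (s := 3) (by norm_num)
  have hF0s : Summable (fun p : ℕ × ℕ => 1 / ((p.1 : ℝ) + 1) ^ 3 * (1 / hd p.2 ^ 2)) :=
    hz3.summable.mul_of_nonneg hT2.summable (fun _ => by positivity) (fun n => by have := hd_pos n; positivity)
  have hF0 := hz3.mul hT2 hF0s
  have hBs : Summable (fun p : ℕ × ℕ => 1 / ((p.1 : ℝ) + 1) ^ 2 * (1 / hd p.2 ^ 2)) :=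
    hz2.summable.mul_of_nonneg hT2.summable (fun _ => by positivity) (fun n => by have := hd_pos n; positivity)
  have hF1s : Summable (fun p : ℕ × ℕ => 1 / (((p.1 : ℝ) + 1) ^ 3 * (hd p.2 ^ 2 - ((p.1 : ℝ) + 1) ^ 2))) :=
    Summable.of_norm_bounded (hBs.mul_left 8) (fun p => bound_F1 p.1 p.2)
  obtain ⟨t, hF1⟩ := hF1s
  have fib1 : ∀ k : ℕ, HasSum (fun n : ℕ => 1 / (((k : ℝ) + 1) ^ 3 * (hd n ^ 2 - ((k : ℝ) + 1) ^ 2))) 0 := by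
    intro k
    have hs := hF1.summable.prod_factor k
    have h1 := hs.hasSum.tendsto_sum_nat
    have h2 := (tend_D (k + 1)).const_mul (1 / (2 * ((k : ℝ) + 1) ^ 4))
    rw [mul_zero] at h2
    have h3 := tendsto_nhds_unique (h2.congr fun N => ?_) h1
    · rw [h3]; exact hs.hasSum
    · rw [mul_sum]
      refine sum_congr rfl fun n _ => ?_
      have a1 := hd_ne n (k + 1)
      have a2 := hd_sq_ne n k
      have a3 := hd_pos n
      push_cast at a1 ⊢
      have a4 : hd n + ((k : ℝ) + 1) ≠ 0 := by positivity
      field_simp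
      ring
  have ht : t = 0 := (hF1.prod_fiberwise fib1).unique hasSum_zero
  subst ht
  have hF2 : HasSum (fun p : ℕ × ℕ => 1 / (hd p.1 ^ 2 * (((p.2 : ℝ) + 1) * (hd p.1 ^ 2 - ((p.2 : ℝ) + 1) ^ 2))))
      (0 - zetaVal 3 * ((2 ^ 2 - 1) * zetaVal 2)) := by
    have := (Equiv.prodComm ℕ ℕ).hasSum_iff.2 (hF1.sub hF0)
    refine this.congr_fun fun p => ?_
    simp only [Function.comp, Equiv.prodComm_apply, Prod.fst_swap, Prod.snd_swap]
    have a2 := hd_sq_ne p.1 p.2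
    have a3 := hd_pos p.1
    field_simp
    ring
  have fib2 : ∀ n : ℕ, HasSum (fun k : ℕ => 1 / (hd n ^ 2 * (((k : ℝ) + 1) * (hd n ^ 2 - ((k : ℝ) + 1) ^ 2))))
      (1 / hd n ^ 4 * (PP n + 1 / (2 * hd n) - 2 * Real.log 2)) := by
    intro n
    have hs := hF2.summable.prod_factor n
    have h1 := hs.hasSum.tendsto_sum_nat
    have h2 := (tend_C n).const_mul (1 / hd n ^ 4)
    have h3 := tendsto_nhds_unique (h2.congr fun N => ?_) h1
    · rw [h3]; exact hs.hasSum
    · rw [mul_sum]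
      refine sum_congr rfl fun k _ => ?_
      have a1 := hd_ne n (k + 1)
      have a2 := hd_sq_ne n k
      have a3 := hd_pos n
      push_cast at a1
      have a4 : hd n + ((k : ℝ) + 1) ≠ 0 := by positivity
      field_simp
      ring
  have h := ((hF2.prod_fiberwise fib2).add (hT5.mul_left (1 / 2))).add (hT4.mul_left (2 * Real.log 2))
  have e : 0 - zetaVal 3 * ((2 ^ 2 - 1) * zetaVal 2) + 1 / 2 * ((2 ^ 5 - 1) * zetaVal 5) +
      2 * Real.log 2 * ((2 ^ 4 - 1) * zetaVal 4) =
      30 * Real.log 2 * zetaVal 4 + 31 / 2 * zetaVal 5 - 3 * zetaVal 2 * zetaVal 3 := by ring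
  rw [e] at h
  refine h.congr_fun fun m => ?_
  have := hd_pos m
  field_simp
  ring

end Apery
namespace Apery
open Finset Filter Topology MeasureTheory

lemma cont_mul_log_pow (n : ℕ) : ContinuousOn (fun y : ℝ => y * Real.log y ^ n) (Set.Ici 0) := by
  rcases Nat.eq_zero_or_pos n with rfl | hn
  · simp only [pow_zero, mul_one]; exact continuousOn_id
  have hn' : (n : ℝ) ≠ 0 := by positivity
  have h1 : Continuous (fun y : ℝ => y ^ (1 / (n : ℝ))) :=
    Real.continuous_rpow_const (by positivity)
  have h2 : Continuous (fun y : ℝ => (n : ℝ) ^ n * (y ^ (1 / (n : ℝ)) * Real.log (y ^ (1 / (n : ℝ)))) ^ n) :=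
    ((Real.continuous_mul_log.comp h1).pow n).const_mul _ |>.congr (fun y => rfl)
  refine h2.continuousOn.congr fun y hy => ?_
  rcases eq_or_lt_of_le (show (0:ℝ) ≤ y from hy) with rfl | hy
  · simp [hn.ne']
  · simp only
    rw [Real.log_rpow hy, mul_pow, mul_pow, ← Real.rpow_natCast (y ^ (1 / (n:ℝ))), ← Real.rpow_mul hy.le,
      one_div_mul_cancel hn', Real.rpow_one, one_div, inv_pow]
    field_simp

noncomputable def ww (φ : ℝ) : ℝ := -2 * Real.log (Real.cos φ)

lemma cos_nonneg_Icc {φ : ℝ} (h : φ ∈ Set.Icc 0 (π / 2)) : 0 ≤ Real.cos φ :=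
  Real.cos_nonneg_of_mem_Icc ⟨by linarith [h.1, Real.pi_pos], h.2⟩

lemma cos_pos_Ioo {φ : ℝ} (h : φ ∈ Set.Ioo 0 (π / 2)) : 0 < Real.cos φ :=
  Real.cos_pos_of_mem_Ioo ⟨by linarith [h.1, Real.pi_pos], h.2⟩

lemma sin_pos_Ioo {φ : ℝ} (h : φ ∈ Set.Ioo 0 (π / 2)) : 0 < Real.sin φ :=
  Real.sin_pos_of_pos_of_lt_pi h.1 (by linarith [h.2, Real.pi_pos])

lemma ww_nonneg (φ : ℝ) (h : φ ∈ Set.Icc 0 (π / 2)) : 0 ≤ ww φ := by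
  unfold ww
  have := Real.log_nonpos (cos_nonneg_Icc h) (Real.cos_le_one φ)
  linarith

lemma cont_cos_ww (n : ℕ) : ContinuousOn (fun φ => Real.cos φ * ww φ ^ n) (Set.Icc 0 (π / 2)) := by
  have h := (cont_mul_log_pow n).comp Real.continuous_cos.continuousOn
    (s := Set.Icc 0 (π/2)) (fun x hx => cos_nonneg_Icc hx)
  refine (h.const_mul ((-2)^n)).congr fun x _ => ?_
  simp only [ww, Function.comp, mul_pow]; ring

lemma hasDeriv_ww {φ : ℝ} (h : φ ∈ Set.Ioo 0 (π / 2)) :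
    HasDerivAt ww (2 * Real.sin φ / Real.cos φ) φ := by
  have := ((Real.hasDerivAt_cos φ).log (cos_pos_Ioo h).ne').const_mul (-2)
  refine this.congr_deriv ?_
  ring

noncomputable def JJ (n k : ℕ) (φ : ℝ) : ℝ :=
  2 * ((k : ℝ) + 1) * Real.sin φ ^ (2 * k + 1) * (Real.cos φ * ww φ ^ n) / (n.factorial : ℝ)

lemma cont_JJ (n k : ℕ) : ContinuousOn (JJ n k) (Set.Icc 0 (π / 2)) := by
  unfold JJ
  exact ((Continuous.continuousOn (by fun_prop)).mul (cont_cos_ww n)).div_const _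

lemma int_JJ (n k : ℕ) : IntervalIntegrable (JJ n k) volume 0 (π / 2) :=
  (by rw [Set.uIcc_of_le (by positivity : (0:ℝ) ≤ π/2)]; exact cont_JJ n k : ContinuousOn _ (Set.uIcc 0 (π/2))).intervalIntegrable

/-- complete homogeneous symmetric functions of 1, 1/2, ..., 1/k -/
noncomputable def hs : ℕ → ℕ → ℝ
  | 0, _ => 1
  | _ + 1, 0 => 0
  | n + 1, k + 1 => hs (n + 1) k + hs n (k + 1) / ((k : ℝ) + 1)

lemma JJ_step (n k : ℕ) : (∫ φ in (0:ℝ)..(π / 2),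
    (2 * (k : ℝ) * Real.sin φ ^ (2 * k - 1) * (Real.cos φ * ww φ ^ (n + 1)) / ((n + 1).factorial : ℝ)))
      + (∫ φ in (0:ℝ)..(π / 2), JJ n k φ) / ((k : ℝ) + 1) = ∫ φ in (0:ℝ)..(π / 2), JJ (n + 1) k φ := by
  have hpi : (0:ℝ) ≤ π / 2 := by positivity
  have i1 : IntervalIntegrable (fun φ => 2 * (k : ℝ) * Real.sin φ ^ (2 * k - 1) * (Real.cos φ * ww φ ^ (n + 1)) / ((n + 1).factorial : ℝ)) volume 0 (π / 2) := by
    apply ContinuousOn.intervalIntegrable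
    rw [Set.uIcc_of_le hpi]
    exact ((Continuous.continuousOn (by fun_prop)).mul (cont_cos_ww (n+1))).div_const _
  have i2 := (int_JJ n k).div_const ((k:ℝ) + 1)
  have i3 := int_JJ (n + 1) k
  have key := intervalIntegral.integral_eq_sub_of_hasDerivAt_of_le hpi
    (f := fun φ => Real.sin φ ^ (2 * k) * Real.cos φ * (Real.cos φ * ww φ ^ (n + 1)) / ((n + 1).factorial : ℝ))
    (f' := fun φ => (2 * (k : ℝ) * Real.sin φ ^ (2 * k - 1) * (Real.cos φ * ww φ ^ (n + 1)) / ((n + 1).factorial : ℝ)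
      + JJ n k φ / ((k : ℝ) + 1)) - JJ (n + 1) k φ)
    (((Continuous.continuousOn (by fun_prop)).mul (cont_cos_ww (n+1))).div_const _) ?_ ((i1.add i2).sub i3)
  · rw [intervalIntegral.integral_sub (i1.add i2) i3, intervalIntegral.integral_add i1 i2,
      intervalIntegral.integral_div] at key
    rw [show Real.cos (π / 2) = 0 from Real.cos_pi_div_two, show ww 0 = 0 by simp [ww]] at key
    simp only [ne_eq, Nat.succ_ne_zero, not_false_eq_true, zero_pow, mul_zero, zero_mul, zero_div, sub_zero, intervalIntegral.integral_div] at key ⊢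
    linarith
  · intro φ hφ
    have hc := (cos_pos_Ioo hφ).ne'
    have d1 := (Real.hasDerivAt_sin φ).pow (2 * k)
    have d2 := Real.hasDerivAt_cos φ
    have d3 := (hasDeriv_ww hφ).pow (n + 1)
    have := ((d1.mul d2).mul (d2.mul d3)).div_const ((n + 1).factorial : ℝ)
    refine this.congr_deriv ?_
    simp only [Pi.pow_apply, Pi.mul_apply]
    unfold JJ
    rw [Nat.factorial_succ]
    have hf : (n.factorial : ℝ) ≠ 0 := by positivity
    have hk : (k : ℝ) + 1 ≠ 0 := by positivity
    have hn : (n : ℝ) + 1 ≠ 0 := by positivity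
    push_cast
    try rw [Nat.add_sub_cancel]
    generalize ww φ = w
    have hs := Real.sin_sq_add_cos_sq φ
    have hs3 : Real.cos φ ^ 2 = 1 - Real.sin φ ^ 2 := by linarith
    rcases k with _ | k
    · simp only [mul_zero, pow_zero]
      field_simp
      push_cast
      ring
    · have e1 : 2 * (k + 1) - 1 = 2 * k + 1 := by omega
      have e2 : 2 * (k + 1) + 1 = 2 * k + 3 := by omega
      have e3 : 2 * (k + 1) = 2 * k + 2 := by omega
      rw [e1, e2, e3]
      field_simp
      push_cast
      ring_nf
      rw [hs3]
      ring_nf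

lemma JJ_zero (k : ℕ) : ∫ φ in (0:ℝ)..(π / 2), JJ 0 k φ = 1 := by
  have hpi : (0:ℝ) ≤ π / 2 := by positivity
  rw [intervalIntegral.integral_eq_sub_of_hasDerivAt_of_le hpi
    (f := fun φ => Real.sin φ ^ (2 * k + 2)) (by fun_prop) ?_ (int_JJ 0 k)]
  · simp
  · intro φ hφ
    refine ((Real.hasDerivAt_sin φ).pow (2 * k + 2)).congr_deriv ?_
    unfold JJ
    simp only [show 2 * k + 2 - 1 = 2 * k + 1 by omega, pow_zero, Nat.factorial_zero, Nat.cast_one]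
    push_cast
    ring

lemma JJ_eq (n k : ℕ) : ∫ φ in (0:ℝ)..(π / 2), JJ n k φ = hs n (k + 1) := by
  induction n generalizing k with
  | zero => rw [JJ_zero]; simp [hs]
  | succ n ih =>
    induction k with
    | zero =>
      rw [← JJ_step, ih]; simp [hs]
    | succ k ih2 =>
      rw [← JJ_step, ih, hs, ← ih2]
      congr 1
      refine intervalIntegral.integral_congr fun φ _ => ?_
      simp only [JJ]
      rw [show 2 * (k + 1) - 1 = 2 * k + 1 by omega]
      push_cast
      ring

lemma tele_deriv (n : ℕ) (φ : ℝ) : HasDerivAt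
    (fun x => Real.cos x * ∑ k ∈ range n, bet k 0 * Real.sin x ^ (2 * k + 1))
    (2 - bet n 0 * (2 * n + 1) * Real.sin φ ^ (2 * n)) φ := by
  induction n with
  | zero =>
    simp [bet_zero, hd]
    exact hasDerivAt_const _ _
  | succ n ih =>
    have := ih.add (((Real.hasDerivAt_cos φ).mul ((Real.hasDerivAt_sin φ).pow (2 * n + 1))).const_mul (bet n 0))
    refine (this.congr_deriv ?_).congr_of_eventuallyEq (Eventually.of_forall fun x => ?_)
    · rw [bet_succ_left]
      have hs3 : Real.cos φ ^ 2 = 1 - Real.sin φ ^ 2 := by linarith [Real.sin_sq_add_cos_sq φ]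
      simp only [Pi.pow_apply, hd]
      have : (n:ℝ) + 1 + ((0:ℕ) + 1/2) ≠ 0 := by positivity
      push_cast at this ⊢
      have e : bet n 0 * (((n:ℝ) + 1) / ((n:ℝ) + 1 + (0 + 1 / 2))) * (2 * ((n:ℝ) + 1) + 1) = bet n 0 * (2 * (n + 1)) := by
        field_simp; ring
      rw [e]; try rw [Nat.add_sub_cancel]
      have : Real.cos φ * ((2 * n + 1) * Real.sin φ ^ (2 * n) * Real.cos φ) = (2 * n + 1) * Real.sin φ ^ (2 * n) * Real.cos φ ^ 2 := by ring
      rw [this, hs3]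
      ring
    · simp only [sum_range_succ, Pi.add_apply, Pi.mul_apply, Pi.pow_apply]
      ring

lemma arcsin_series {φ : ℝ} (h : φ ∈ Set.Ioo 0 (π / 2)) :
    HasSum (fun k : ℕ => bet k 0 * Real.sin φ ^ (2 * k + 1) * Real.cos φ) (2 * φ) := by
  have hs := sin_pos_Ioo h
  have hc := cos_pos_Ioo h
  rw [hasSum_iff_tendsto_nat_of_nonneg (fun k => by have := bet_pos k 0; positivity)]
  have hs1 : Real.sin φ ^ 2 < 1 := by nlinarith [Real.sin_sq_add_cos_sq φ]
  have b : ∀ n : ℕ, ‖(∑ k ∈ range n, bet k 0 * Real.sin φ ^ (2 * k + 1) * Real.cos φ) - 2 * φ‖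
      ≤ 4 * φ * (n * (Real.sin φ ^ 2) ^ n) + 2 * φ * (Real.sin φ ^ 2) ^ n := by
    intro n
    have hd0 : ∀ x ∈ Set.Icc 0 φ, HasDerivWithinAt
      (fun x => Real.cos x * ∑ k ∈ range n, bet k 0 * Real.sin x ^ (2 * k + 1) - 2 * x)
      (- (bet n 0 * (2 * n + 1) * Real.sin x ^ (2 * n))) (Set.Icc 0 φ) x := by
      intro x _
      refine (((tele_deriv n x).sub ((hasDerivAt_id x).const_mul 2)).congr_deriv ?_).hasDerivWithinAt
      ring
    have := Convex.norm_image_sub_le_of_norm_hasDerivWithin_le hd0 (C := 2 * (2 * n + 1) * (Real.sin φ ^ 2) ^ n) ?_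
      (convex_Icc 0 φ) (Set.left_mem_Icc.2 h.1.le) (Set.right_mem_Icc.2 h.1.le)
    · simp only [Real.sin_zero, sub_zero, mul_zero, Real.norm_of_nonneg h.1.le] at this
      rw [show (∑ k ∈ range n, bet k 0 * (0:ℝ) ^ (2 * k + 1)) = 0 from sum_eq_zero fun k _ => by simp] at this
      rw [mul_zero, sub_zero, mul_comm (Real.cos φ), sum_mul] at this
      refine this.trans (le_of_eq ?_)
      ring
    · intro x hx
      have hx0 : 0 ≤ Real.sin x := Real.sin_nonneg_of_nonneg_of_le_pi hx.1 (by linarith [hx.2, h.2, Real.pi_pos])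
      have hx1 : Real.sin x ≤ Real.sin φ :=
        Real.sin_le_sin_of_le_of_le_pi_div_two (by linarith [hx.1, Real.pi_pos]) h.2.le hx.2
      have hb := bet_le_inv n 0
      have hb2 := bet_pos n 0
      have hb3 : (1:ℝ) / hd 0 = 2 := by simp [hd]
      rw [norm_neg, Real.norm_of_nonneg (by positivity), ← pow_mul]
      rw [hb3] at hb
      gcongr
  have t1 := (tendsto_self_mul_const_pow_of_lt_one (sq_nonneg _) hs1).const_mul (4 * φ)
  have t2 := (tendsto_pow_atTop_nhds_zero_of_lt_one (sq_nonneg _) hs1).const_mul (2 * φ)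
  have t3 := t1.add t2
  rw [mul_zero, mul_zero, add_zero] at t3
  rw [tendsto_iff_norm_sub_tendsto_zero]
  exact squeeze_zero (fun _ => norm_nonneg _) b t3


lemma int_log_cos_pow (n : ℕ) : IntegrableOn (fun φ => |Real.log (Real.cos φ)| ^ n) (Set.Ioo 0 (π / 2)) := by
  have hpi := Real.pi_pos
  have h1 : IntervalIntegrable (fun x : ℝ => x ^ (-1/2 : ℝ)) volume 0 (π / 2) :=
    intervalIntegral.intervalIntegrable_rpow' (by norm_num)
  have h2 := (h1.comp_sub_left (π / 2)).symm
  rw [sub_self, sub_zero, intervalIntegrable_iff_integrableOn_Ioo_of_le (by positivity)] at h2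
  have h3 := h2.const_mul ((2 * (n + 1 : ℝ)) ^ n * ((2 / π) ^ (-1/2 : ℝ) ))
  refine Integrable.mono' h3 ?_ ?_
  · apply Measurable.aestronglyMeasurable
    fun_prop
  · rw [ae_restrict_iff' measurableSet_Ioo]
    refine Eventually.of_forall fun φ hφ => ?_
    have hc := cos_pos_Ioo hφ
    have hc1 := Real.cos_le_one φ
    have hy : 2 / π * (π / 2 - φ) ≤ Real.cos φ := by
      rw [← Real.sin_pi_div_two_sub]
      exact Real.mul_le_sin (by linarith [hφ.2]) (by linarith [hφ.1])
    have hy0 : 0 < π / 2 - φ := by linarith [hφ.2]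
    have ht : (0:ℝ) < 1 / (2 * (n + 1 : ℝ)) := by positivity
    have h := (Real.abs_log_mul_self_rpow_lt (Real.cos φ) _ hc hc1 ht).le
    rw [abs_mul, one_div_one_div, abs_of_pos (Real.rpow_pos_of_pos hc _)] at h
    have h' : |Real.log (Real.cos φ)| ≤ 2 * (n + 1) * Real.cos φ ^ (-(1 / (2 * (n + 1 : ℝ)))) := by
      rw [Real.rpow_neg hc.le, ← div_eq_mul_inv, le_div_iff₀ (Real.rpow_pos_of_pos hc _)]
      exact h
    rw [Real.norm_of_nonneg (by positivity)]
    calc |Real.log (Real.cos φ)| ^ n ≤ (2 * (n + 1) * Real.cos φ ^ (-(1 / (2 * (n + 1 : ℝ))))) ^ n := by gcongr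
      _ = (2 * (n + 1 : ℝ)) ^ n * Real.cos φ ^ (-(1 / (2 * (n + 1 : ℝ))) * n) := by
        rw [mul_pow, ← Real.rpow_natCast (Real.cos φ ^ _), ← Real.rpow_mul hc.le]
      _ ≤ (2 * (n + 1 : ℝ)) ^ n * Real.cos φ ^ (-1/2 : ℝ) := by
        gcongr ?_ * ?_
        apply Real.rpow_le_rpow_of_exponent_ge hc hc1
        rw [neg_mul, one_div_mul_eq_div, neg_div, neg_le_neg_iff, div_le_div_iff₀ (by positivity) (by norm_num)]
        linarith
      _ ≤ (2 * (n + 1 : ℝ)) ^ n * (2 / π * (π / 2 - φ)) ^ (-1/2 : ℝ) := by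
        gcongr ?_ * ?_
        exact Real.rpow_le_rpow_of_nonpos (by positivity) hy (by norm_num)
      _ = _ := by
        rw [Real.mul_rpow (by positivity) hy0.le]; ring

lemma sum_X1 : HasSum (fun k : ℕ => bet k 0 / ((k : ℝ) + 1) * hs 3 (k + 1))
    (-(16 / 3) * ∫ φ in Set.Ioo 0 (π / 2), φ * Real.log (Real.cos φ) ^ 3) := by
  have hpi : (0:ℝ) ≤ π / 2 := by positivity
  have hlim : ∀ φ ∈ Set.Ioo 0 (π / 2), HasSum (fun k : ℕ => bet k 0 / ((k : ℝ) + 1) * JJ 3 k φ)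
      (-(16 / 3) * (φ * Real.log (Real.cos φ) ^ 3)) := by
    intro φ hφ
    have h := (arcsin_series hφ).mul_right (ww φ ^ 3 / 3)
    have e : 2 * φ * (ww φ ^ 3 / 3) = -(16 / 3) * (φ * Real.log (Real.cos φ) ^ 3) := by
      unfold ww; ring
    rw [e] at h
    refine h.congr_fun fun k => ?_
    have : (k:ℝ) + 1 ≠ 0 := by positivity
    simp only [JJ, Nat.factorial]
    field_simp
    norm_num
    try ring
  have hnn : ∀ φ ∈ Set.Ioo 0 (π / 2), ∀ k : ℕ, 0 ≤ bet k 0 / ((k : ℝ) + 1) * JJ 3 k φ := by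
    intro φ hφ k
    have := (bet_pos k 0).le
    have h1 := (cos_pos_Ioo hφ).le
    have h2 := (sin_pos_Ioo hφ).le
    have h3 := ww_nonneg φ ⟨hφ.1.le, hφ.2.le⟩
    unfold JJ
    positivity
  have hInteg : IntegrableOn (fun φ => -(16 / 3) * (φ * Real.log (Real.cos φ) ^ 3)) (Set.Ioo 0 (π / 2)) := by
    refine Integrable.mono' ((int_log_cos_pow 3).const_mul (16 / 3 * (π / 2))) ?_ ?_
    · apply Measurable.aestronglyMeasurable
      fun_prop
    · rw [ae_restrict_iff' measurableSet_Ioo]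
      refine Eventually.of_forall fun φ hφ => ?_
      rw [norm_mul, norm_mul, norm_pow, Real.norm_of_nonneg hφ.1.le, Real.norm_eq_abs, Real.norm_eq_abs, abs_neg,
        abs_of_pos (by norm_num : (0:ℝ) < 16 / 3), ← mul_assoc]
      gcongr
      exact hφ.2.le
  have hm : ∀ k : ℕ, AEStronglyMeasurable (fun φ => bet k 0 / ((k : ℝ) + 1) * JJ 3 k φ)
      (volume.restrict (Set.Ioo 0 (π / 2))) := by
    intro k
    apply Measurable.aestronglyMeasurable
    unfold JJ ww
    fun_prop
  have h := hasSum_integral_of_dominated_convergence (μ := volume.restrict (Set.Ioo 0 (π / 2)))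
    (F := fun k φ => bet k 0 / ((k : ℝ) + 1) * JJ 3 k φ)
    (f := fun φ => -(16 / 3) * (φ * Real.log (Real.cos φ) ^ 3))
    (fun k φ => bet k 0 / ((k : ℝ) + 1) * JJ 3 k φ) hm ?_ ?_ ?_ ?_
  · rw [integral_const_mul] at h
    refine h.congr_fun fun k => ?_
    rw [integral_const_mul, ← JJ_eq, intervalIntegral.integral_of_le hpi, integral_Ioc_eq_integral_Ioo]
  · intro k
    rw [ae_restrict_iff' measurableSet_Ioo]
    refine Eventually.of_forall fun φ hφ => ?_
    rw [Real.norm_of_nonneg (hnn φ hφ k)]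
  · rw [ae_restrict_iff' measurableSet_Ioo]
    exact Eventually.of_forall fun φ hφ => (hlim φ hφ).summable
  · refine hInteg.congr_fun (fun φ hφ => ?_) measurableSet_Ioo
    exact (hlim φ hφ).tsum_eq.symm
  · rw [ae_restrict_iff' measurableSet_Ioo]
    exact Eventually.of_forall hlim

lemma bet_eq (k : ℕ) : bet k 0 / ((k : ℝ) + 1) =
    4 ^ (k + 1) / (((k : ℝ) + 1) ^ 2 * (Nat.choose (2 * (k + 1)) (k + 1) : ℝ)) := by
  have key : bet k 0 * (Nat.centralBinom (k + 1) : ℝ) * ((k : ℝ) + 1) = 4 ^ (k + 1) := by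
    induction k with
    | zero => simp [bet_zero, hd, Nat.centralBinom]; norm_num
    | succ k ih =>
      have h : ((k + 1 + 1 : ℕ) : ℝ) * Nat.centralBinom (k + 1 + 1) = ((2 * (2 * (k + 1) + 1) : ℕ) : ℝ) * Nat.centralBinom (k + 1) := by
        exact_mod_cast Nat.succ_mul_centralBinom_succ (k + 1)
      rw [bet_succ_left, pow_succ, ← ih]
      push_cast at h ⊢
      have e : bet k 0 * (((k:ℝ) + 1) / ((k:ℝ) + 1 + hd 0)) * (Nat.centralBinom (k + 1 + 1) : ℝ) * ((k:ℝ) + 1 + 1)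
        = bet k 0 * (((k:ℝ) + 1) / ((k:ℝ) + 1 + hd 0)) * (((k:ℝ) + 1 + 1) * (Nat.centralBinom (k + 1 + 1) : ℝ)) := by ring
      rw [e, h]
      have : (k:ℝ) + 1 + hd 0 ≠ 0 := by have := hd_pos 0; positivity
      simp only [hd] at this ⊢
      field_simp
      push_cast
      ring
  have hc : (0:ℝ) < (Nat.centralBinom (k + 1) : ℝ) := by exact_mod_cast Nat.centralBinom_pos _
  rw [Nat.centralBinom] at key hc
  rw [← key]
  field_simp

lemma gh_succ (k m : ℕ) : genHarmonic (k + 1) m = genHarmonic k m + 1 / ((k : ℝ) + 1) ^ m := by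
  simp [genHarmonic, sum_range_succ]

lemma gh_zero (m : ℕ) : genHarmonic 0 m = 0 := by simp [genHarmonic]

lemma es1 (k : ℕ) : es 1 k = genHarmonic k 1 := by
  induction k with
  | zero => rw [es_succ_zero, gh_zero]
  | succ k ih => rw [es_succ_succ, gh_succ, ih, es_zero, pow_one]

lemma es2 (k : ℕ) : es 2 k = (genHarmonic k 1 ^ 2 - genHarmonic k 2) / 2 := by
  induction k with
  | zero => rw [es_succ_zero, gh_zero, gh_zero]; simp
  | succ k ih =>
    rw [es_succ_succ, gh_succ, gh_succ, ih, es1]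
    generalize (k : ℝ) + 1 = x
    ring

lemma es3 (k : ℕ) : es 3 k = (genHarmonic k 1 ^ 3 - 3 * genHarmonic k 1 * genHarmonic k 2 + 2 * genHarmonic k 3) / 6 := by
  induction k with
  | zero => rw [es_succ_zero, gh_zero, gh_zero, gh_zero]; simp
  | succ k ih =>
    rw [es_succ_succ, gh_succ, gh_succ, gh_succ, ih, es2]
    generalize (k : ℝ) + 1 = x
    ring

lemma hs1 (k : ℕ) : hs 1 k = genHarmonic k 1 := by
  induction k with
  | zero => rw [gh_zero]; simp [hs]
  | succ k ih => rw [hs, gh_succ, ih, hs, pow_one]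

lemma hs2 (k : ℕ) : hs 2 k = (genHarmonic k 1 ^ 2 + genHarmonic k 2) / 2 := by
  induction k with
  | zero => rw [gh_zero, gh_zero]; simp [hs]
  | succ k ih =>
    rw [hs, gh_succ, gh_succ, ih, hs1, gh_succ]
    generalize (k : ℝ) + 1 = x
    ring

lemma hs3 (k : ℕ) : hs 3 k = (genHarmonic k 1 ^ 3 + 3 * genHarmonic k 1 * genHarmonic k 2 + 2 * genHarmonic k 3) / 6 := by
  induction k with
  | zero => rw [gh_zero, gh_zero, gh_zero]; simp [hs]
  | succ k ih =>
    rw [hs, gh_succ, gh_succ, gh_succ, ih, hs2, gh_succ, gh_succ]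
    generalize (k : ℝ) + 1 = x
    ring

lemma main_hasSum : HasSum (fun k : ℕ => (4 : ℝ) ^ (k + 1) * (genHarmonic (k + 1) 1 * genHarmonic (k + 1) 2) /
      ((k + 1 : ℝ) ^ 2 * (Nat.choose (2 * (k + 1)) (k + 1) : ℝ)))
    (-(16 / 3) * (∫ φ in Set.Ioo 0 (π / 2), φ * Real.log (Real.cos φ) ^ 3) -
      (30 * Real.log 2 * zetaVal 4 + 31 / 2 * zetaVal 5 - 3 * zetaVal 2 * zetaVal 3)) := by
  refine (sum_X1.sub (sum_Y Y_hasSum)).congr_fun fun k => ?_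
  rw [bet_eq, hs3, es3]
  ring

end Apery
namespace Apery
open Finset Filter Topology MeasureTheory

noncomputable def lg (z : ℂ) : ℂ := Complex.log (1 + z) - (Real.log 2 : ℝ)

noncomputable def arc (ρ φ : ℝ) : ℂ := ρ * Complex.exp (2 * φ * Complex.I)

lemma arc_norm {ρ : ℝ} (h : 0 ≤ ρ) (φ : ℝ) : ‖arc ρ φ‖ = ρ := by
  unfold arc
  rw [norm_mul, show (2 * φ * Complex.I : ℂ) = ((2 * φ : ℝ) : ℂ) * Complex.I by push_cast; ring,
    Complex.norm_exp_ofReal_mul_I, mul_one, Complex.norm_of_nonneg h]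

lemma arc_re (ρ φ : ℝ) : (arc ρ φ).re = ρ * Real.cos (2 * φ) := by
  unfold arc
  rw [show (2 * φ * Complex.I : ℂ) = ((2 * φ : ℝ) : ℂ) * Complex.I by push_cast; ring,
    Complex.re_ofReal_mul, Complex.exp_ofReal_mul_I_re]

lemma arc_im (ρ φ : ℝ) : (arc ρ φ).im = ρ * Real.sin (2 * φ) := by
  unfold arc
  rw [show (2 * φ * Complex.I : ℂ) = ((2 * φ : ℝ) : ℂ) * Complex.I by push_cast; ring,
    Complex.im_ofReal_mul, Complex.exp_ofReal_mul_I_im]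

lemma one_add_mem_slit {z : ℂ} (h : ‖z‖ < 1) : 1 + z ∈ Complex.slitPlane := by
  left
  have := Complex.abs_re_le_norm z
  rw [Complex.add_re, Complex.one_re]
  linarith [neg_abs_le z.re]

lemma norm_arc_sq (ρ φ : ℝ) : ‖1 + arc ρ φ‖ ^ 2 = (1 - ρ) ^ 2 + 4 * ρ * Real.cos φ ^ 2 := by
  rw [← Complex.normSq_eq_norm_sq, Complex.normSq_apply]
  simp only [Complex.add_re, Complex.add_im, Complex.one_re, Complex.one_im, arc_re, arc_im]
  have h1 := Real.sin_sq_add_cos_sq (2 * φ)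
  have h2 := Real.cos_two_mul φ
  have : (1 + ρ * Real.cos (2 * φ)) * (1 + ρ * Real.cos (2 * φ)) + (0 + ρ * Real.sin (2 * φ)) * (0 + ρ * Real.sin (2 * φ))
    = 1 + 2 * ρ * Real.cos (2 * φ) + ρ ^ 2 * (Real.sin (2 * φ) ^ 2 + Real.cos (2 * φ) ^ 2) := by ring
  rw [this, h1, h2]
  ring

lemma abs_log_norm_le {ρ φ : ℝ} (h1 : 1 / 4 ≤ ρ) (h2 : ρ ≤ 1) (hφ : φ ∈ Set.Ioo 0 (π / 2)) :
    |Real.log ‖1 + arc ρ φ‖| ≤ |Real.log (Real.cos φ)| + 1 := by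
  have hc := cos_pos_Ioo hφ
  have hn := norm_arc_sq ρ φ
  have l1 : Real.cos φ ≤ ‖1 + arc ρ φ‖ := by
    apply le_of_sq_le_sq _ (norm_nonneg _) 
    rw [hn]
    nlinarith [sq_nonneg (1 - ρ), sq_nonneg (Real.cos φ)]
  have l2 : ‖1 + arc ρ φ‖ ≤ 2 := by
    refine (norm_add_le _ _).trans ?_
    rw [norm_one, arc_norm (by linarith)]
    linarith
  have m1 := Real.log_le_log hc l1
  have m2 := Real.log_le_log (hc.trans_le l1) l2
  have := Real.log_two_lt_d9
  rw [abs_le]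
  have := abs_nonneg (Real.log (Real.cos φ))
  have := neg_abs_le (Real.log (Real.cos φ))
  constructor <;> linarith

lemma lg_bound {ρ φ : ℝ} (h1 : 1 / 4 ≤ ρ) (h2 : ρ ≤ 1) (hφ : φ ∈ Set.Ioo 0 (π / 2)) :
    ‖lg (arc ρ φ)‖ ≤ |Real.log (Real.cos φ)| + 6 := by
  unfold lg
  refine (norm_sub_le _ _).trans ?_
  have a1 := Complex.norm_le_abs_re_add_abs_im (Complex.log (1 + arc ρ φ))
  rw [Complex.log_re, Complex.log_im] at a1
  have a2 := abs_log_norm_le h1 h2 hφ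
  have a3 := Complex.abs_arg_le_pi (1 + arc ρ φ)
  have a4 := Real.pi_lt_four
  have a5 := Real.log_two_lt_d9
  rw [Complex.norm_of_nonneg (Real.log_nonneg (by norm_num))]
  linarith

lemma lg_one {φ : ℝ} (hφ : φ ∈ Set.Ioo 0 (π / 2)) :
    lg (arc 1 φ) = (Real.log (Real.cos φ) : ℝ) + (φ : ℝ) * Complex.I := by
  have hc := cos_pos_Ioo hφ
  have e : 1 + arc 1 φ = ((2 * Real.cos φ : ℝ) : ℂ) * Complex.exp (φ * Complex.I) := by
    apply Complex.ext
    · rw [Complex.add_re, arc_re, Complex.re_ofReal_mul, Complex.exp_ofReal_mul_I_re, Real.cos_two_mul]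
      simp; ring
    · rw [Complex.add_im, arc_im, Complex.im_ofReal_mul, Complex.exp_ofReal_mul_I_im, Real.sin_two_mul]
      simp; ring
  unfold lg
  rw [e, Complex.log_ofReal_mul (by positivity) (Complex.exp_ne_zero _), Complex.log_exp, Real.log_mul (by norm_num) hc.ne']
  · push_cast; ring
  · simp; linarith [hφ.1, Real.pi_pos]
  · simp; linarith [hφ.2, Real.pi_pos]

lemma lg_one_im {φ : ℝ} (hφ : φ ∈ Set.Ioo 0 (π / 2)) :
    (lg (arc 1 φ) ^ 4).im = 4 * (φ * Real.log (Real.cos φ) ^ 3) - 4 * (φ ^ 3 * Real.log (Real.cos φ)) := by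
  rw [lg_one hφ]
  generalize Real.log (Real.cos φ) = l
  have : ((l : ℂ) + (φ : ℝ) * Complex.I) ^ 4 =
      ((l ^ 4 - 6 * l ^ 2 * φ ^ 2 + φ ^ 4 : ℝ) : ℂ) + ((4 * (φ * l ^ 3) - 4 * (φ ^ 3 * l) : ℝ) : ℂ) * Complex.I := by
    push_cast
    have i2 := Complex.I_sq
    have i3 : Complex.I ^ 3 = - Complex.I := by rw [pow_succ, i2]; ring
    have i4 : Complex.I ^ 4 = 1 := Complex.I_pow_four
    ring_nf
    rw [i2, i3, i4]
    ring
  rw [this]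
  simp [-Complex.ofReal_add, -Complex.ofReal_sub, -Complex.ofReal_mul]

lemma one_add_arc_slit {ρ φ : ℝ} (h : 0 < ρ) (h1 : ρ ≤ 1) (hφ : φ ∈ Set.Ioo 0 (π / 2)) : 1 + arc ρ φ ∈ Complex.slitPlane := by
  left
  have hc := cos_pos_Ioo hφ
  rw [Complex.add_re, arc_re, Real.cos_two_mul, Complex.one_re]
  nlinarith [mul_pos h (pow_pos hc 2)]

lemma tend_lg {φ : ℝ} (hφ : φ ∈ Set.Ioo 0 (π / 2)) :
    Tendsto (fun ρ : ℝ => lg (arc ρ φ)) (𝓝[<] 1) (𝓝 (lg (arc 1 φ))) := by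
  have : ContinuousAt (fun ρ : ℝ => lg (arc ρ φ)) 1 := by
    unfold lg
    refine ContinuousAt.sub (ContinuousAt.clog ?_ (one_add_arc_slit one_pos le_rfl hφ)) continuousAt_const
    unfold arc
    fun_prop
  exact this.tendsto.mono_left nhdsWithin_le_nhds

lemma ev_rho : ∀ᶠ ρ : ℝ in 𝓝[<] 1, 1 / 4 ≤ ρ ∧ ρ < 1 := by
  have : Set.Ioo (1 / 4 : ℝ) 1 ∈ 𝓝[<] (1:ℝ) := Ioo_mem_nhdsLT (by norm_num)
  filter_upwards [this] with ρ h
  exact ⟨h.1.le, h.2⟩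

lemma cont_arc (ρ : ℝ) : Continuous (arc ρ) := by unfold arc; fun_prop

lemma meas_lg_arc (ρ : ℝ) : Measurable (fun φ => lg (arc ρ φ)) := by
  unfold lg
  have := (cont_arc ρ).measurable
  fun_prop

lemma int_log_cos_pow' (n : ℕ) (C : ℝ) : IntegrableOn (fun φ => C * |Real.log (Real.cos φ)| ^ n) (Set.Ioo 0 (π / 2)) :=
  (int_log_cos_pow n).const_mul C

lemma int_bound4 : IntegrableOn (fun φ => (|Real.log (Real.cos φ)| + 6) ^ 4) (Set.Ioo 0 (π / 2)) := by
  have e : (fun φ => (|Real.log (Real.cos φ)| + 6) ^ 4) = fun φ => (1 * |Real.log (Real.cos φ)| ^ 4 + 24 * |Real.log (Real.cos φ)| ^ 3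
    + 216 * |Real.log (Real.cos φ)| ^ 2 + 864 * |Real.log (Real.cos φ)| ^ 1 + 1296 * |Real.log (Real.cos φ)| ^ 0) := by
    funext φ; ring
  rw [e]
  exact ((((int_log_cos_pow' 4 _).add (int_log_cos_pow' 3 _)).add (int_log_cos_pow' 2 _)).add (int_log_cos_pow' 1 _)).add (int_log_cos_pow' 0 _)

lemma tend_arc_int : Tendsto (fun ρ : ℝ => ∫ φ in Set.Ioo 0 (π / 2), (lg (arc ρ φ) ^ 4).im) (𝓝[<] 1)
    (𝓝 (∫ φ in Set.Ioo 0 (π / 2), (lg (arc 1 φ) ^ 4).im)) := by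
  refine tendsto_integral_filter_of_dominated_convergence (fun φ => (|Real.log (Real.cos φ)| + 6) ^ 4) ?_ ?_ int_bound4 ?_
  · refine Eventually.of_forall fun ρ => ?_
    have := meas_lg_arc ρ
    apply Measurable.aestronglyMeasurable
    fun_prop
  · filter_upwards [ev_rho] with ρ hρ
    rw [ae_restrict_iff' measurableSet_Ioo]
    refine Eventually.of_forall fun φ hφ => ?_
    refine (Complex.abs_im_le_norm _).trans ?_
    rw [norm_pow]
    gcongr
    exact lg_bound hρ.1 hρ.2.le hφ
  · rw [ae_restrict_iff' measurableSet_Ioo]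
    refine Eventually.of_forall fun φ hφ => ?_
    exact (Complex.continuous_im.tendsto _).comp ((tend_lg hφ).pow 4)

lemma arc_int_val : ∫ φ in Set.Ioo 0 (π / 2), (lg (arc 1 φ) ^ 4).im =
    4 * (∫ φ in Set.Ioo 0 (π / 2), φ * Real.log (Real.cos φ) ^ 3) - 4 * ∫ φ in Set.Ioo 0 (π / 2), φ ^ 3 * Real.log (Real.cos φ) := by
  rw [setIntegral_congr_fun measurableSet_Ioo (fun φ hφ => lg_one_im hφ), integral_sub, integral_const_mul, integral_const_mul]
  · refine Integrable.const_mul ?_ _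
    refine Integrable.mono' (int_log_cos_pow' 3 (π / 2)) (Measurable.aestronglyMeasurable (by fun_prop)) ?_
    rw [ae_restrict_iff' measurableSet_Ioo]
    refine Eventually.of_forall fun φ hφ => ?_
    rw [norm_mul, norm_pow, Real.norm_of_nonneg hφ.1.le, Real.norm_eq_abs]
    gcongr
    exact hφ.2.le
  · refine Integrable.const_mul ?_ _
    refine Integrable.mono' (int_log_cos_pow' 1 ((π / 2) ^ 3)) (Measurable.aestronglyMeasurable (by fun_prop)) ?_
    rw [ae_restrict_iff' measurableSet_Ioo]
    refine Eventually.of_forall fun φ hφ => ?_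
    rw [norm_mul, norm_pow, Real.norm_of_nonneg hφ.1.le, Real.norm_eq_abs, pow_one]
    have := hφ.1.le
    gcongr
    exact hφ.2.le

/-- The integrand on the real segment. -/
noncomputable def NN (v : ℝ) : ℝ := (v - Real.log 2) ^ 4 - Real.log 2 ^ 4

lemma contour (ρ : ℝ) (h0 : 0 < ρ) (h1 : ρ < 1) :
    2 * ∫ φ in Set.Ioo 0 (π / 2), (lg (arc ρ φ) ^ 4).im =
      (∫ v in (0:ℝ)..Real.log (1 + ρ), (NN v + NN v / (Real.exp v - 1)))
      - ∫ x in (0:ℝ)..(-Real.log (1 - ρ)), NN (-x) / (Real.exp x - 1) := by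
  set g : ℂ → ℂ := fun z => lg z ^ 4 with hg
  have hgd : DifferentiableOn ℂ g (Metric.ball 0 1) := by
    intro z hz
    rw [mem_ball_zero_iff] at hz
    have := one_add_mem_slit hz
    have h : DifferentiableAt ℂ (fun z : ℂ => Complex.log (1 + z)) z := DifferentiableAt.clog (by fun_prop) this
    exact ((h.sub_const _).pow 4).differentiableWithinAt
  have hds : DifferentiableOn ℂ (dslope g 0) (Metric.ball 0 1) :=
    (Complex.differentiableOn_dslope (Metric.ball_mem_nhds 0 one_pos)).2 hgd
  obtain ⟨G, hG⟩ := hds.isExactOn_ball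
  have hcont : ContinuousOn (dslope g 0) (Metric.ball 0 1) := hds.continuousOn
  have hg0 : g 0 = ((Real.log 2 ^ 4 : ℝ) : ℂ) := by
    simp only [hg, lg, add_zero, Complex.log_one, zero_sub]
    push_cast; ring
  have hsl : ∀ z, z * dslope g 0 z = g z - g 0 := by
    intro z
    have := sub_smul_dslope g 0 z
    simpa using this
  -- the arc
  have harc : ∀ φ, arc ρ φ ∈ Metric.ball (0:ℂ) 1 := by
    intro φ
    rw [mem_ball_zero_iff, arc_norm h0.le]; exact h1
  have hgarc : Continuous (fun φ => g (arc ρ φ)) := by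
    have := hgd.continuousOn.comp_continuous (cont_arc ρ) harc
    exact this
  have ha : ∫ φ in (0:ℝ)..(π / 2), (2 * Complex.I * (g (arc ρ φ) - g 0)) = G (arc ρ (π / 2)) - G (arc ρ 0) := by
    refine intervalIntegral.integral_eq_sub_of_hasDerivAt (f := fun φ => G (arc ρ φ)) ?_ ?_
    · intro φ _
      have d1 := hG _ (harc φ)
      have d2 : HasDerivAt (arc ρ) (2 * Complex.I * arc ρ φ) φ := by
        have d3 : HasDerivAt (fun x : ℝ => (2 * x * Complex.I : ℂ)) (2 * Complex.I) φ := by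
          have := ((Complex.ofRealCLM.hasDerivAt (x := φ)).const_mul (2:ℂ)).mul_const Complex.I
          simpa using this
        have := (d3.cexp).const_mul (ρ : ℂ)
        refine this.congr_deriv ?_
        unfold arc; ring
      refine (HasDerivAt.comp_of_eq φ d1 d2 rfl).congr_deriv ?_
      rw [← hsl]; ring
    · exact (continuous_const.mul (hgarc.sub continuous_const)).intervalIntegrable _ _
  have e1 : arc ρ (π / 2) = ((-ρ : ℝ) : ℂ) := by
    apply Complex.ext
    · rw [arc_re, show 2 * (π / 2) = π by ring, Real.cos_pi, Complex.ofReal_re]; ring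
    · rw [arc_im, show 2 * (π / 2) = π by ring, Real.sin_pi, Complex.ofReal_im]; ring
  have e2 : arc ρ 0 = ((ρ : ℝ) : ℂ) := by simp [arc]
  rw [e1, e2] at ha
  have ha2 : - (2 * ∫ φ in Set.Ioo 0 (π / 2), (lg (arc ρ φ) ^ 4).im) = (G ((-ρ : ℝ) : ℂ)).re - (G (ρ : ℂ)).re := by
    rw [← Complex.sub_re, ← ha, ← integral_Ioc_eq_integral_Ioo, ← intervalIntegral.integral_of_le (by positivity)]
    have hii : IntervalIntegrable (fun φ => 2 * Complex.I * (g (arc ρ φ) - g 0)) volume 0 (π / 2) :=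
      (continuous_const.mul (hgarc.sub continuous_const)).intervalIntegrable _ _
    have := Complex.reCLM.intervalIntegral_comp_comm hii
    simp only [Complex.reCLM_apply] at this
    rw [← this, ← intervalIntegral.integral_const_mul, ← intervalIntegral.integral_neg]
    refine intervalIntegral.integral_congr fun φ _ => ?_
    change -(2 * (g (arc ρ φ)).im) = (2 * Complex.I * (g (arc ρ φ) - g 0)).re
    rw [hg0]
    simp only [Complex.mul_re, Complex.mul_im, Complex.sub_re, Complex.sub_im, Complex.I_re, Complex.I_im, Complex.ofReal_im,
      Complex.re_ofNat, Complex.im_ofNat]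
    ring
  -- the segment
  have hexp : ∀ v : ℝ, v < Real.log 2 → ((Real.exp v - 1 : ℝ) : ℂ) ∈ Metric.ball (0:ℂ) 1 := by
    intro v hv
    rw [mem_ball_zero_iff, Complex.norm_real, Real.norm_eq_abs, abs_lt]
    have h3 := Real.exp_pos v
    have h4 := (Real.lt_log_iff_exp_lt (by norm_num)).1 hv
    constructor <;> linarith
  have hgv : ∀ v : ℝ, g ((Real.exp v - 1 : ℝ) : ℂ) - g 0 = (NN v : ℝ) := by
    intro v
    rw [hg0]
    simp only [hg, lg, NN]
    rw [show (1 : ℂ) + ((Real.exp v - 1 : ℝ) : ℂ) = ((Real.exp v : ℝ) : ℂ) by push_cast; ring,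
      ← Complex.ofReal_log (Real.exp_pos v).le, Real.log_exp]
    push_cast; ring
  have hseg : ∀ a b : ℝ, a < Real.log 2 → b < Real.log 2 →
      ∫ v in a..b, (NN v * Real.exp v / (Real.exp v - 1)) = (G ((Real.exp b - 1 : ℝ) : ℂ)).re - (G ((Real.exp a - 1 : ℝ) : ℂ)).re := by
    intro a b ha hb
    have hlt : ∀ v ∈ Set.uIcc a b, v < Real.log 2 := by
      intro v hv
      have := hv.2
      exact this.trans_lt (max_lt ha hb)
    have hii : IntervalIntegrable (fun v : ℝ => ((Real.exp v : ℝ) : ℂ) * dslope g 0 ((Real.exp v - 1 : ℝ) : ℂ)) volume a b := by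
      apply ContinuousOn.intervalIntegrable
      refine ContinuousOn.mul (Continuous.continuousOn (by fun_prop)) ?_
      exact hcont.comp (Continuous.continuousOn (by fun_prop)) (fun v hv => hexp v (hlt v hv))
    have hb : ∫ v in a..b, ((Real.exp v : ℝ) : ℂ) * dslope g 0 ((Real.exp v - 1 : ℝ) : ℂ) =
        G ((Real.exp b - 1 : ℝ) : ℂ) - G ((Real.exp a - 1 : ℝ) : ℂ) := by
      refine intervalIntegral.integral_eq_sub_of_hasDerivAt (f := fun v : ℝ => G ((Real.exp v - 1 : ℝ) : ℂ)) ?_ hii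
      intro v hv
      have d1 := hG _ (hexp v (hlt v hv))
      have d2 := ((Real.hasDerivAt_exp v).sub_const 1).ofReal_comp
      refine (HasDerivAt.comp_of_eq v d1 d2 rfl).congr_deriv ?_
      ring
    rw [← Complex.sub_re, ← hb]
    have := Complex.reCLM.intervalIntegral_comp_comm hii
    simp only [Complex.reCLM_apply] at this
    rw [← this]
    refine intervalIntegral.integral_congr_ae ?_
    have h0 : ∀ᵐ v : ℝ ∂volume, v ≠ 0 := by
      simp [ae_iff, measure_singleton]
    filter_upwards [h0] with v hv _
    have hne : Real.exp v - 1 ≠ 0 := by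
      rw [sub_ne_zero]; simpa using hv
    have hne' : ((Real.exp v - 1 : ℝ) : ℂ) ≠ 0 := by exact_mod_cast hne
    have : dslope g 0 ((Real.exp v - 1 : ℝ) : ℂ) = ((NN v / (Real.exp v - 1) : ℝ) : ℂ) := by
      apply mul_left_cancel₀ hne'
      rw [hsl, hgv, ← Complex.ofReal_mul, mul_div_cancel₀ _ hne]
    rw [this, ← Complex.ofReal_mul, Complex.ofReal_re]
    ring
  have l2 : (0:ℝ) < Real.log 2 := Real.log_pos (by norm_num)
  have s1 := hseg 0 (Real.log (1 + ρ)) l2 (Real.log_lt_log (by linarith) (by linarith))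
  have s2 := hseg (Real.log (1 - ρ)) 0 (Real.log_lt_log (by linarith) (by linarith)) l2
  rw [Real.exp_log (by linarith), Real.exp_zero, sub_self, show 1 + ρ - 1 = ρ by ring] at s1
  rw [Real.exp_log (by linarith), Real.exp_zero, sub_self, show 1 - ρ - 1 = -ρ by ring] at s2
  have h0 : ∀ᵐ v : ℝ ∂volume, v ≠ 0 := by
      simp [ae_iff, measure_singleton]
  have r1 : ∫ v in (0:ℝ)..Real.log (1 + ρ), (NN v + NN v / (Real.exp v - 1)) = ∫ v in (0:ℝ)..Real.log (1 + ρ), (NN v * Real.exp v / (Real.exp v - 1)) := by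
    refine intervalIntegral.integral_congr_ae ?_
    filter_upwards [h0] with v hv _
    have hne : Real.exp v - 1 ≠ 0 := by
      rw [sub_ne_zero]; simpa using hv
    field_simp
    ring
  have r2 : ∫ x in (0:ℝ)..(-Real.log (1 - ρ)), NN (-x) / (Real.exp x - 1) = - ∫ v in Real.log (1 - ρ)..0, (NN v * Real.exp v / (Real.exp v - 1)) := by
    have := intervalIntegral.integral_comp_neg (a := 0) (b := -Real.log (1 - ρ)) (fun v => NN v * Real.exp v / (Real.exp v - 1))
    rw [neg_neg, neg_zero] at this
    rw [← this, ← intervalIntegral.integral_neg]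
    refine intervalIntegral.integral_congr_ae ?_
    filter_upwards [h0] with v hv _
    have hne : Real.exp v - 1 ≠ 0 := by
      rw [sub_ne_zero]; simpa using hv
    have hne2 : Real.exp (-v) - 1 ≠ 0 := by
      rw [sub_ne_zero]; simpa using hv
    rw [Real.exp_neg] at hne2 ⊢
    have := Real.exp_pos v
    have h5 : 1 - Real.exp v ≠ 0 := by rw [← neg_ne_zero]; simpa using hne
    field_simp
    rw [← neg_sub (Real.exp v) 1]
    field_simp
  rw [r1, r2, s1, s2]
  linarith

end Apery
namespace Apery
open Finset Filter Topology MeasureTheory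

lemma moment (m n : ℕ) : ∫ x in Set.Ioi (0:ℝ), x ^ m * Real.exp (-(((n:ℝ) + 1) * x)) = m.factorial / ((n:ℝ) + 1) ^ (m + 1) := by
  have h := Real.integral_rpow_mul_exp_neg_mul_Ioi (a := (m:ℝ) + 1) (r := (n:ℝ) + 1) (by positivity) (by positivity)
  rw [Real.Gamma_nat_eq_factorial, add_sub_cancel_right] at h
  simp only [Real.rpow_natCast] at h
  rw [h, show (m:ℝ) + 1 = ((m + 1 : ℕ) : ℝ) by push_cast; rfl, Real.rpow_natCast, one_div, inv_pow]
  field_simp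

lemma moment_int (m n : ℕ) : IntegrableOn (fun x : ℝ => x ^ m * Real.exp (-(((n:ℝ) + 1) * x))) (Set.Ioi 0) :=
  .of_integral_ne_zero (by rw [moment]; positivity)

lemma bose (m : ℕ) {c S : ℝ} (hc : 1 ≤ c) (hS : HasSum (fun n : ℕ => (1 / c) ^ (n + 1) / ((n:ℝ) + 1) ^ (m + 1)) S) :
    ∫ x in Set.Ioi (0:ℝ), x ^ m / (c * Real.exp x - 1) = m.factorial * S := by
  have hc0 : 0 < c := by linarith
  have hval : ∀ n : ℕ, ∫ x in Set.Ioi (0:ℝ), (1 / c) ^ (n + 1) * (x ^ m * Real.exp (-(((n:ℝ) + 1) * x))) =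
      m.factorial * ((1 / c) ^ (n + 1) / ((n:ℝ) + 1) ^ (m + 1)) := by
    intro n
    rw [integral_const_mul, moment]; ring
  have h := hasSum_integral_of_summable_integral_norm (μ := volume.restrict (Set.Ioi (0:ℝ)))
    (F := fun (n : ℕ) (x : ℝ) => (1 / c) ^ (n + 1) * (x ^ m * Real.exp (-(((n:ℝ) + 1) * x))))
    (fun n => (moment_int m n).const_mul _) ?_
  · simp only [hval] at h
    have h2 := h.unique (hS.mul_left (m.factorial : ℝ))
    rw [← h2]
    refine setIntegral_congr_fun measurableSet_Ioi fun x hx => ?_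
    have hx : 0 < x := hx
    have he : 1 < Real.exp x := by rw [← Real.exp_zero]; exact Real.exp_lt_exp.2 hx
    have hr : 1 / (c * Real.exp x) < 1 := by
      rw [div_lt_one (by positivity)]
      nlinarith
    have hg := ((hasSum_geometric_of_lt_one (by positivity) hr).mul_left (x ^ m * (1 / (c * Real.exp x))))
    have : HasSum (fun n : ℕ => (1 / c) ^ (n + 1) * (x ^ m * Real.exp (-(((n:ℝ) + 1) * x))))
        (x ^ m * (1 / (c * Real.exp x)) * (1 - 1 / (c * Real.exp x))⁻¹) := by
      refine hg.congr_fun fun n => ?_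
      rw [show -(((n:ℝ) + 1) * x) = ((n + 1 : ℕ) : ℝ) * (-x) by push_cast; ring, Real.exp_nat_mul, Real.exp_neg]
      rw [one_div, one_div, mul_inv, mul_pow, pow_succ, pow_succ]
      ring
    rw [this.tsum_eq]
    have h3 : c * Real.exp x - 1 ≠ 0 := by nlinarith
    have h4 : 1 - 1 / (c * Real.exp x) ≠ 0 := by linarith
    field_simp
  · refine (hS.mul_left (m.factorial : ℝ)).summable.congr fun n => ?_
    rw [← hval]
    refine setIntegral_congr_fun measurableSet_Ioi fun x hx => ?_
    have hx : 0 < x := hx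
    rw [Real.norm_of_nonneg (by positivity)]

lemma bose1 (m : ℕ) : ∫ x in Set.Ioi (0:ℝ), x ^ (m + 1) / (Real.exp x - 1) = (m + 1).factorial * zetaVal (m + 2) := by
  have := bose (m + 1) le_rfl (S := zetaVal (m + 2)) (by
    simpa using zeta_hasSum (s := m + 2) (by omega))
  simpa using this

lemma zeta_pos (m : ℕ) : 0 < zetaVal (m + 2) :=
  (zeta_hasSum (s := m + 2) (by omega)).summable.tsum_pos (fun n => by positivity) 0 (by positivity)

lemma bose1_int (m : ℕ) : IntegrableOn (fun x : ℝ => x ^ (m + 1) / (Real.exp x - 1)) (Set.Ioi 0) :=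
  .of_integral_ne_zero (by rw [bose1]; have := zeta_pos m; positivity)

lemma bose2_0 : ∫ x in Set.Ioi (0:ℝ), 1 / (2 * Real.exp x - 1) = Real.log 2 := by
  have h := Real.hasSum_pow_div_log_of_abs_lt_one (x := 1 / 2) (by rw [abs_of_pos] <;> norm_num)
  have e : -Real.log (1 - 1 / 2) = Real.log 2 := by
    rw [show (1:ℝ) - 1 / 2 = 2⁻¹ by norm_num, Real.log_inv, neg_neg]
  rw [e] at h
  have := bose 0 one_le_two (S := Real.log 2) (by simpa using h)
  simpa using this

lemma li_hasSum : HasSum (fun n : ℕ => (1 / 2 : ℝ) ^ (n + 1) / ((n:ℝ) + 1) ^ 5) (polyLog 5 (1 / 2)) := by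
  have : Summable (fun n : ℕ => (1 / 2 : ℝ) ^ (n + 1) / ((n:ℝ) + 1) ^ 5) := by
    refine Summable.of_nonneg_of_le (fun n => by positivity) (fun n => ?_) (zeta_hasSum (s := 5) (by norm_num)).summable
    gcongr
    exact pow_le_one₀ (by norm_num) (by norm_num)
  exact this.hasSum

lemma bose2_4 : ∫ x in Set.Ioi (0:ℝ), x ^ 4 / (2 * Real.exp x - 1) = 24 * polyLog 5 (1 / 2) := by
  have := bose 4 one_le_two li_hasSum
  simpa [Nat.factorial] using this

lemma bose2_0_int : IntegrableOn (fun x : ℝ => 1 / (2 * Real.exp x - 1)) (Set.Ioi 0) :=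
  .of_integral_ne_zero (by rw [bose2_0]; have := Real.log_pos one_lt_two; positivity)

lemma bose2_4_int : IntegrableOn (fun x : ℝ => x ^ 4 / (2 * Real.exp x - 1)) (Set.Ioi 0) :=
  .of_integral_ne_zero (by
    rw [bose2_4]
    have : 0 < polyLog 5 (1 / 2) := li_hasSum.summable.tsum_pos (fun n => by positivity) 0 (by positivity)
    positivity)

lemma NN_expand (v : ℝ) : NN v / (Real.exp v - 1) = v ^ 4 / (Real.exp v - 1) + (-(4 * Real.log 2)) * (v ^ 3 / (Real.exp v - 1))
    + 6 * Real.log 2 ^ 2 * (v ^ 2 / (Real.exp v - 1)) + (-(4 * Real.log 2 ^ 3)) * (v ^ 1 / (Real.exp v - 1)) := by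
  unfold NN; ring

lemma NN_expand' (v : ℝ) : NN (-v) / (Real.exp v - 1) = v ^ 4 / (Real.exp v - 1) + (4 * Real.log 2) * (v ^ 3 / (Real.exp v - 1))
    + 6 * Real.log 2 ^ 2 * (v ^ 2 / (Real.exp v - 1)) + (4 * Real.log 2 ^ 3) * (v ^ 1 / (Real.exp v - 1)) := by
  unfold NN; ring

lemma comb_int (a b c : ℝ) : IntegrableOn (fun v : ℝ => v ^ 4 / (Real.exp v - 1) + a * (v ^ 3 / (Real.exp v - 1))
    + b * (v ^ 2 / (Real.exp v - 1)) + c * (v ^ 1 / (Real.exp v - 1))) (Set.Ioi 0) :=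
  (((bose1_int 3).add ((bose1_int 2).const_mul a)).add ((bose1_int 1).const_mul b)).add ((bose1_int 0).const_mul c)

lemma comb_val (a b c : ℝ) : ∫ v in Set.Ioi (0:ℝ), (v ^ 4 / (Real.exp v - 1) + a * (v ^ 3 / (Real.exp v - 1))
    + b * (v ^ 2 / (Real.exp v - 1)) + c * (v ^ 1 / (Real.exp v - 1))) =
    24 * zetaVal 5 + a * (6 * zetaVal 4) + b * (2 * zetaVal 3) + c * zetaVal 2 := by
  have i4 := bose1_int 3
  have i3 := (bose1_int 2).const_mul a
  have i2 := (bose1_int 1).const_mul b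
  have i1 := (bose1_int 0).const_mul c
  have v4 := bose1 3
  have v3 := bose1 2
  have v2 := bose1 1
  have v1 := bose1 0
  norm_num [Nat.factorial] at i4 i3 i2 i1 v4 v3 v2 v1
  simp only [pow_one]
  have j1 : Integrable (fun v : ℝ => v ^ 4 / (Real.exp v - 1) + a * (v ^ 3 / (Real.exp v - 1))) (volume.restrict (Set.Ioi 0)) := i4.add i3
  have j2 : Integrable (fun v : ℝ => v ^ 4 / (Real.exp v - 1) + a * (v ^ 3 / (Real.exp v - 1))
    + b * (v ^ 2 / (Real.exp v - 1))) (volume.restrict (Set.Ioi 0)) := j1.add i2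
  rw [integral_add j2 i1, integral_add j1 i2, integral_add i4 i3,
    integral_const_mul, integral_const_mul, integral_const_mul, v4, v3, v2, v1]

lemma tail_val : ∫ v in Set.Ioi (Real.log 2), NN v / (Real.exp v - 1) = 24 * polyLog 5 (1 / 2) - Real.log 2 ^ 5 := by
  have h := (measurePreserving_add_right (volume : Measure ℝ) (Real.log 2)).setIntegral_preimage_emb
    (measurableEmbedding_addRight (Real.log 2)) (fun v => NN v / (Real.exp v - 1)) (Set.Ioi (Real.log 2))
  rw [← h]
  have e : (fun x => x + Real.log 2) ⁻¹' Set.Ioi (Real.log 2) = Set.Ioi (0:ℝ) := by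
    ext x; simp
  rw [e]
  have : ∀ x : ℝ, NN (x + Real.log 2) / (Real.exp (x + Real.log 2) - 1) =
      x ^ 4 / (2 * Real.exp x - 1) - Real.log 2 ^ 4 * (1 / (2 * Real.exp x - 1)) := by
    intro x
    rw [Real.exp_add, Real.exp_log (by norm_num), NN]
    ring
  simp only [this]
  rw [integral_sub bose2_4_int (bose2_0_int.const_mul _), integral_const_mul, bose2_4, bose2_0]
  ring

/-- the value of the segment integral -/
noncomputable def E5 : ℝ := -24 * polyLog 5 (1 / 2) + Real.log 2 ^ 5 / 5 - 8 * Real.log 2 ^ 3 * zetaVal 2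
  - 48 * Real.log 2 * zetaVal 4

lemma NN_int : IntegrableOn (fun v => NN v / (Real.exp v - 1)) (Set.Ioi 0) := by
  simp only [NN_expand]; exact comb_int _ _ _

lemma NN_int' : IntegrableOn (fun v => NN (-v) / (Real.exp v - 1)) (Set.Ioi 0) := by
  simp only [NN_expand']; exact comb_int _ _ _

lemma head_val : ∫ v in (0:ℝ)..Real.log 2, (NN v + NN v / (Real.exp v - 1)) =
    (Real.log 2 ^ 5 / 5 - Real.log 2 ^ 5) + ((24 * zetaVal 5 + (-(4 * Real.log 2)) * (6 * zetaVal 4) +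
      6 * Real.log 2 ^ 2 * (2 * zetaVal 3) + (-(4 * Real.log 2 ^ 3)) * zetaVal 2) -
      (24 * polyLog 5 (1 / 2) - Real.log 2 ^ 5)) := by
  have l2 : (0:ℝ) ≤ Real.log 2 := Real.log_nonneg (by norm_num)
  have hi : IntervalIntegrable (fun v => NN v / (Real.exp v - 1)) volume 0 (Real.log 2) := by
    rw [intervalIntegrable_iff_integrableOn_Ioc_of_le l2]
    exact NN_int.mono_set Set.Ioc_subset_Ioi_self
  have hc : Continuous NN := by unfold NN; fun_prop
  rw [intervalIntegral.integral_add (hc.intervalIntegrable _ _) hi]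
  congr 1
  · have : ∀ v, HasDerivAt (fun v => (v - Real.log 2) ^ 5 / 5 - Real.log 2 ^ 4 * v) (NN v) v := by
      intro v
      have := ((((hasDerivAt_id v).sub_const (Real.log 2)).pow 5).div_const 5).sub ((hasDerivAt_id v).const_mul (Real.log 2 ^ 4))
      refine this.congr_deriv ?_
      simp [NN]
    rw [intervalIntegral.integral_eq_sub_of_hasDerivAt (fun v _ => this v) (hc.intervalIntegrable _ _)]
    ring
  · have e1 := comb_val (-(4 * Real.log 2)) (6 * Real.log 2 ^ 2) (-(4 * Real.log 2 ^ 3))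
    simp only [← NN_expand] at e1
    rw [← e1, ← tail_val, intervalIntegral.integral_of_le l2]
    rw [← Set.Ioc_union_Ioi_eq_Ioi l2, setIntegral_union (Set.Ioc_disjoint_Ioi le_rfl) measurableSet_Ioi
      (NN_int.mono_set Set.Ioc_subset_Ioi_self) (NN_int.mono_set (Set.Ioi_subset_Ioi l2))]
    ring

lemma contour_limit : 2 * (4 * (∫ φ in Set.Ioo 0 (π / 2), φ * Real.log (Real.cos φ) ^ 3) -
    4 * ∫ φ in Set.Ioo 0 (π / 2), φ ^ 3 * Real.log (Real.cos φ)) = E5 := by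
  rw [← arc_int_val]
  have t1 := tend_arc_int.const_mul 2
  have l2 : (0:ℝ) ≤ Real.log 2 := Real.log_nonneg (by norm_num)
  have hc : Continuous NN := by unfold NN; fun_prop
  have hi : IntegrableOn (fun v => NN v + NN v / (Real.exp v - 1)) (Set.uIcc 0 (Real.log 2)) := by
    rw [Set.uIcc_of_le l2, integrableOn_Icc_iff_integrableOn_Ioc]
    exact ((hc.integrableOn_Icc (a := 0) (b := Real.log 2)).mono_set Set.Ioc_subset_Icc_self).add
      (NN_int.mono_set Set.Ioc_subset_Ioi_self)
  have c1 := intervalIntegral.continuousOn_primitive_interval hi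
  have t2 : Tendsto (fun ρ : ℝ => ∫ v in (0:ℝ)..Real.log (1 + ρ), (NN v + NN v / (Real.exp v - 1))) (𝓝[<] 1)
      (𝓝 (∫ v in (0:ℝ)..Real.log 2, (NN v + NN v / (Real.exp v - 1)))) := by
    have := c1 (Real.log 2) Set.right_mem_uIcc
    refine this.tendsto.comp (tendsto_nhdsWithin_iff.2 ⟨?_, ?_⟩)
    · have : ContinuousAt (fun ρ : ℝ => Real.log (1 + ρ)) 1 :=
        ContinuousAt.log (by fun_prop) (by norm_num)
      have := this.tendsto.mono_left (nhdsWithin_le_nhds (s := Set.Iio 1))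
      norm_num at this
      exact this
    · filter_upwards [ev_rho] with ρ hρ
      rw [Set.uIcc_of_le l2]
      exact ⟨Real.log_nonneg (by linarith [hρ.1]), Real.log_le_log (by linarith [hρ.1]) (by linarith [hρ.2])⟩
  have t3 : Tendsto (fun ρ : ℝ => -Real.log (1 - ρ)) (𝓝[<] 1) atTop := by
    rw [tendsto_neg_atTop_iff]
    refine Real.tendsto_log_nhdsGT_zero.comp (tendsto_nhdsWithin_iff.2 ⟨?_, ?_⟩)
    · have : ContinuousAt (fun ρ : ℝ => 1 - ρ) 1 := by fun_prop
      have := this.tendsto.mono_left (nhdsWithin_le_nhds (s := Set.Iio 1))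
      norm_num at this
      exact this
    · filter_upwards [ev_rho] with ρ hρ
      simp; exact hρ.2
  have t4 := intervalIntegral_tendsto_integral_Ioi 0 NN_int' t3
  have e2 := comb_val (4 * Real.log 2) (6 * Real.log 2 ^ 2) (4 * Real.log 2 ^ 3)
  simp only [← NN_expand'] at e2
  rw [e2] at t4
  rw [head_val] at t2
  have t5 := t2.sub t4
  have t6 := t5.congr' (f₂ := fun ρ : ℝ => 2 * ∫ φ in Set.Ioo 0 (π / 2), (lg (arc ρ φ) ^ 4).im) (by
    filter_upwards [ev_rho] with ρ hρ
    exact (contour ρ (by linarith [hρ.1]) hρ.2).symm)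
  rw [tendsto_nhds_unique t1 t6]
  unfold E5
  ring

end Apery
namespace Apery
open Finset Filter Topology MeasureTheory

lemma zeta_hasSum0 {s : ℕ} (hs : 2 ≤ s) : HasSum (fun n : ℕ => 1 / (n : ℝ) ^ s) (zetaVal s) := by
  have h : HasSum (fun n : ℕ => 1 / ((n + 1 : ℕ) : ℝ) ^ s) (zetaVal s) := by
    refine (zeta_hasSum hs).congr_fun fun n => ?_
    push_cast; rfl
  have := (hasSum_nat_add_iff (f := fun n : ℕ => 1 / (n : ℝ) ^ s) 1).1 h
  simpa [show s ≠ 0 by omega] using this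

lemma eta5 : HasSum (fun n : ℕ => (-1 : ℝ) ^ (n + 1) / (n : ℝ) ^ 5) (15 / 16 * zetaVal 5) := by
  have he : HasSum (fun k : ℕ => (-1 : ℝ) ^ (2 * k + 1) / ((2 * k : ℕ) : ℝ) ^ 5) (-(1 / 32) * zetaVal 5) := by
    refine ((zeta_hasSum0 (s := 5) (by norm_num)).mul_left (-(1 / 32))).congr_fun fun k => ?_
    rw [pow_succ, pow_mul]
    push_cast
    rw [mul_pow]
    norm_num
    ring
  have ho : HasSum (fun k : ℕ => (-1 : ℝ) ^ (2 * k + 1 + 1) / ((2 * k + 1 : ℕ) : ℝ) ^ 5) (1 / 32 * ((2 ^ 5 - 1) * zetaVal 5)) := by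
    refine ((T_hasSum (s := 5) (by norm_num)).mul_left (1 / 32)).congr_fun fun k => ?_
    rw [show 2 * k + 1 + 1 = 2 * (k + 1) by ring, pow_mul]
    unfold hd
    rw [show ((k : ℝ) + 1 / 2) = (((2 * k + 1 : ℕ) : ℝ)) / 2 by push_cast; ring]
    norm_num
    field_simp
    norm_num
  have h := HasSum.even_add_odd (f := fun n : ℕ => (-1 : ℝ) ^ (n + 1) / (n : ℝ) ^ 5) he ho
  have e : -(1 / 32) * zetaVal 5 + 1 / 32 * ((2 ^ 5 - 1) * zetaVal 5) = 15 / 16 * zetaVal 5 := by ring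
  rw [e] at h
  exact h

lemma cn_val (n : ℕ) (hn : n ≠ 0) : ∫ φ in Set.Ioo 0 (π / 2), φ ^ 3 * Real.cos (2 * (n * φ)) =
    3 * π ^ 2 * (-1) ^ n / (16 * (n:ℝ) ^ 2) - 3 / 8 * (-1) ^ n / (n:ℝ) ^ 4 + 3 / 8 / (n:ℝ) ^ 4 := by
  have hn' : (n:ℝ) ≠ 0 := by exact_mod_cast hn
  rw [← integral_Ioc_eq_integral_Ioo, ← intervalIntegral.integral_of_le (by positivity)]
  rw [intervalIntegral.integral_eq_sub_of_hasDerivAt (f := fun φ => φ ^ 3 * Real.sin (2 * (n * φ)) / (2 * n)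
      + 3 * φ ^ 2 * Real.cos (2 * (n * φ)) / (4 * n ^ 2) - 3 * φ * Real.sin (2 * (n * φ)) / (4 * n ^ 3)
      - 3 * Real.cos (2 * (n * φ)) / (8 * n ^ 4))]
  · have e : 2 * ((n:ℝ) * (π / 2)) = n * π := by ring
    simp only [e, Real.sin_nat_mul_pi, Real.cos_nat_mul_pi, mul_zero, Real.cos_zero, Real.sin_zero]
    field_simp
    ring
  · intro φ _
    have d0 : HasDerivAt (fun φ : ℝ => 2 * ((n:ℝ) * φ)) (2 * n) φ := by
      have := ((hasDerivAt_id φ).const_mul (n:ℝ)).const_mul 2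
      refine this.congr_deriv ?_
      ring
    have ds := d0.sin
    have dc := d0.cos
    have p1 := hasDerivAt_id φ
    have := ((((p1.pow 3).mul ds).div_const (2 * (n:ℝ))).add ((((p1.pow 2).const_mul 3).mul dc).div_const (4 * (n:ℝ) ^ 2))).sub
      (((p1.const_mul 3).mul ds).div_const (4 * (n:ℝ) ^ 3)) |>.sub ((dc.const_mul 3).div_const (8 * (n:ℝ) ^ 4))
    refine this.congr_deriv ?_
    simp only [id, Pi.pow_apply]
    field_simp
    push_cast
    ring
  · exact (Continuous.intervalIntegrable (by fun_prop) _ _)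

lemma log_series {ρ : ℝ} (h0 : 0 ≤ ρ) (h1 : ρ < 1) (φ : ℝ) :
    HasSum (fun n : ℕ => (-1 : ℝ) ^ (n + 1) * ρ ^ n / n * Real.cos (2 * (n * φ))) (Real.log ‖1 + arc ρ φ‖) := by
  have h := Complex.hasSum_taylorSeries_log (z := arc ρ φ) (by rw [arc_norm h0]; exact h1)
  have h2 := Complex.reCLM.hasSum h
  simp only [Complex.reCLM_apply, Complex.log_re] at h2
  refine h2.congr_fun fun n => ?_
  have e : (-1 : ℂ) ^ (n + 1) * arc ρ φ ^ n / n = (((-1 : ℝ) ^ (n + 1) / n : ℝ) : ℂ) * arc (ρ ^ n) (n * φ) := by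
    unfold arc
    rw [mul_pow, ← Complex.exp_nat_mul]
    push_cast
    rw [show (n : ℂ) * (2 * φ * Complex.I) = 2 * (n * φ) * Complex.I by ring]
    ring
  rw [e, Complex.re_ofReal_mul, arc_re]
  ring

noncomputable def dn (n : ℕ) : ℝ := -(3 * π ^ 2 / 16) * (1 / (n:ℝ) ^ 3) + 3 / 8 * (1 / (n:ℝ) ^ 5) + 3 / 8 * ((-1) ^ (n + 1) / (n:ℝ) ^ 5)

lemma dn_hasSum : HasSum dn (-(3 * π ^ 2 / 16) * zetaVal 3 + 3 / 8 * zetaVal 5 + 3 / 8 * (15 / 16 * zetaVal 5)) :=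
  (((zeta_hasSum0 (by norm_num)).mul_left _).add ((zeta_hasSum0 (by norm_num)).mul_left _)).add (eta5.mul_left _)

lemma int_series {ρ : ℝ} (h0 : 0 ≤ ρ) (h1 : ρ < 1) :
    HasSum (fun n : ℕ => ρ ^ n * dn n) (∫ φ in Set.Ioo 0 (π / 2), φ ^ 3 * Real.log ‖1 + arc ρ φ‖) := by
  have hci : ∀ f : ℝ → ℝ, Continuous f → IntegrableOn f (Set.Ioo 0 (π / 2)) := fun f hf =>
    (hf.integrableOn_Icc).mono_set Set.Ioo_subset_Icc_self
  have hInteg : ∀ n : ℕ, IntegrableOn (fun φ => (-1 : ℝ) ^ (n + 1) * ρ ^ n / n * (φ ^ 3 * Real.cos (2 * (n * φ)))) (Set.Ioo 0 (π / 2)) :=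
    fun n => hci _ (by fun_prop)
  have h := hasSum_integral_of_summable_integral_norm (μ := volume.restrict (Set.Ioo 0 (π / 2)))
    (F := fun (n : ℕ) (φ : ℝ) => (-1 : ℝ) ^ (n + 1) * ρ ^ n / n * (φ ^ 3 * Real.cos (2 * (n * φ)))) hInteg ?_
  · have e : ∫ φ in Set.Ioo 0 (π / 2), (∑' n : ℕ, (-1 : ℝ) ^ (n + 1) * ρ ^ n / n * (φ ^ 3 * Real.cos (2 * (n * φ)))) =
        ∫ φ in Set.Ioo 0 (π / 2), φ ^ 3 * Real.log ‖1 + arc ρ φ‖ := by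
      congr 1
      funext φ
      refine HasSum.tsum_eq (((log_series h0 h1 φ).mul_left (φ ^ 3)).congr_fun fun n => ?_)
      ring
    rw [e] at h
    refine h.congr_fun fun n => ?_
    rcases eq_or_ne n 0 with rfl | hn
    · simp [dn]
    · rw [integral_const_mul, cn_val n hn, dn]
      have hn' : (n:ℝ) ≠ 0 := by exact_mod_cast hn
      have s : ((-1:ℝ) ^ n) ^ 2 = 1 := by rw [← pow_mul, mul_comm, pow_mul]; norm_num
      rw [pow_succ (-1 : ℝ) n]
      generalize (-1:ℝ) ^ n = σ at s ⊢
      field_simp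
      ring_nf
      rw [s]
      ring
  · refine Summable.of_nonneg_of_le (fun n => integral_nonneg fun φ => norm_nonneg _) (fun n => ?_)
      ((summable_geometric_of_lt_one h0 h1).mul_right (∫ φ in Set.Ioo 0 (π / 2), φ ^ 3))
    rw [← integral_const_mul]
    refine setIntegral_mono_on (hInteg n).norm (hci _ (by fun_prop)) measurableSet_Ioo fun φ hφ => ?_
    have := hφ.1.le
    rw [norm_mul, norm_div, norm_mul, norm_mul, norm_pow, norm_neg, norm_one, one_pow, one_mul, norm_pow,
      Real.norm_of_nonneg h0, norm_pow, Real.norm_of_nonneg this, Real.norm_natCast]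
    have c1 := Real.abs_cos_le_one (2 * (n * φ))
    rw [← Real.norm_eq_abs] at c1
    have c2 : ρ ^ n / n ≤ ρ ^ n := by
      rcases eq_or_ne n 0 with rfl | hn
      · simp
      · apply div_le_self (by positivity)
        exact_mod_cast Nat.one_le_iff_ne_zero.2 hn
    calc ρ ^ n / n * (φ ^ 3 * ‖Real.cos (2 * (n * φ))‖) ≤ ρ ^ n * (φ ^ 3 * 1) := by gcongr
      _ = _ := by ring

lemma phi3_int : ∫ φ in Set.Ioo 0 (π / 2), φ ^ 3 * Real.log (Real.cos φ) =
    -(3 * π ^ 2 / 16) * zetaVal 3 + 3 / 8 * zetaVal 5 + 3 / 8 * (15 / 16 * zetaVal 5) - Real.log 2 * π ^ 4 / 64 := by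
  have t1 : Tendsto (fun ρ : ℝ => ∑' n, ρ ^ n * dn n) (𝓝[<] 1) (𝓝 (∑' n, dn n)) := by
    refine tendsto_tsum_of_dominated_convergence (bound := fun n => ‖dn n‖) dn_hasSum.summable.norm ?_ ?_
    · intro n
      have : ContinuousAt (fun ρ : ℝ => ρ ^ n * dn n) 1 := by fun_prop
      have := this.tendsto.mono_left (nhdsWithin_le_nhds (s := Set.Iio 1))
      simpa using this
    · filter_upwards [ev_rho] with ρ hρ n
      have : 0 ≤ ρ := by linarith [hρ.1]
      rw [norm_mul, norm_pow, Real.norm_of_nonneg this]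
      exact mul_le_of_le_one_left (norm_nonneg _) (pow_le_one₀ this hρ.2.le)
  rw [dn_hasSum.tsum_eq] at t1
  have t2 : Tendsto (fun ρ : ℝ => ∫ φ in Set.Ioo 0 (π / 2), φ ^ 3 * Real.log ‖1 + arc ρ φ‖) (𝓝[<] 1)
      (𝓝 (∫ φ in Set.Ioo 0 (π / 2), (φ ^ 3 * Real.log (Real.cos φ) + Real.log 2 * φ ^ 3))) := by
    have hb : IntegrableOn (fun φ => (π / 2) ^ 3 * |Real.log (Real.cos φ)| ^ 1 + (π / 2) ^ 3 * |Real.log (Real.cos φ)| ^ 0)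
        (Set.Ioo 0 (π / 2)) := (int_log_cos_pow' 1 ((π / 2) ^ 3)).add (int_log_cos_pow' 0 ((π / 2) ^ 3))
    refine tendsto_integral_filter_of_dominated_convergence (fun φ => (π / 2) ^ 3 * |Real.log (Real.cos φ)| ^ 1 + (π / 2) ^ 3 * |Real.log (Real.cos φ)| ^ 0) ?_ ?_
      hb ?_
    · refine Eventually.of_forall fun ρ => ?_
      have := (cont_arc ρ).measurable
      apply Measurable.aestronglyMeasurable
      fun_prop
    · filter_upwards [ev_rho] with ρ hρ
      rw [ae_restrict_iff' measurableSet_Ioo]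
      refine Eventually.of_forall fun φ hφ => ?_
      have := hφ.1.le
      rw [norm_mul, norm_pow, Real.norm_of_nonneg this, ← mul_add, pow_one, pow_zero]
      gcongr
      · exact hφ.2.le
      · exact abs_log_norm_le hρ.1 hρ.2.le hφ
    · rw [ae_restrict_iff' measurableSet_Ioo]
      refine Eventually.of_forall fun φ hφ => ?_
      have h := (Complex.continuous_re.tendsto _).comp (tend_lg hφ)
      have h2 := (h.add_const (Real.log 2)).const_mul (φ ^ 3)
      have e : φ ^ 3 * ((lg (arc 1 φ)).re + Real.log 2) = φ ^ 3 * Real.log (Real.cos φ) + Real.log 2 * φ ^ 3 := by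
        rw [lg_one hφ]
        simp; ring
      rw [e] at h2
      refine h2.congr fun ρ => ?_
      simp only [Function.comp, lg, Complex.sub_re, Complex.log_re, Complex.ofReal_re]
      ring
  have t3 := t2.congr' (f₂ := fun ρ : ℝ => ∑' n, ρ ^ n * dn n) (by
    filter_upwards [ev_rho] with ρ hρ
    exact (int_series (by linarith [hρ.1]) hρ.2).tsum_eq.symm)
  have u := tendsto_nhds_unique t1 t3
  rw [integral_add, integral_const_mul, ← integral_Ioc_eq_integral_Ioo (f := fun φ : ℝ => φ ^ 3),
    ← intervalIntegral.integral_of_le (by positivity), integral_pow] at u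
  · push_cast at u
    linear_combination -u
  · refine Integrable.mono' (int_log_cos_pow' 1 ((π / 2) ^ 3)) (Measurable.aestronglyMeasurable (by fun_prop)) ?_
    rw [ae_restrict_iff' measurableSet_Ioo]
    refine Eventually.of_forall fun φ hφ => ?_
    rw [norm_mul, norm_pow, Real.norm_of_nonneg hφ.1.le, Real.norm_eq_abs, pow_one]
    have := hφ.1.le
    gcongr
    exact hφ.2.le
  · exact ((Continuous.integrableOn_Icc (by fun_prop)).mono_set Set.Ioo_subset_Icc_self)

lemma zeta2 : zetaVal 2 = π ^ 2 / 6 := (zeta_hasSum0 (by norm_num)).unique hasSum_zeta_two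
lemma zeta4 : zetaVal 4 = π ^ 4 / 90 := (zeta_hasSum0 (by norm_num)).unique hasSum_zeta_four

end Apery

theorem stmt_4 :
    ∑' k : ℕ, (4 : ℝ) ^ (k + 1) * (genHarmonic (k + 1) 1 * genHarmonic (k + 1) 2) /
      ((k + 1 : ℝ) ^ 2 * (Nat.choose (2 * (k + 1)) (k + 1) : ℝ))
    = -(155 / 8) * zetaVal 5 + 9 * zetaVal 2 * zetaVal 3 + 16 * polyLog 5 (1 / 2)
      + 19 / 2 * Real.log 2 * zetaVal 4 + 16 / 3 * Real.log 2 ^ 3 * zetaVal 2 - 2 / 15 * Real.log 2 ^ 5 := by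
  rw [Apery.main_hasSum.tsum_eq]
  have h1 := Apery.contour_limit
  have h2 := Apery.phi3_int
  rw [h2] at h1
  unfold Apery.E5 at h1
  rw [Apery.zeta2, Apery.zeta4] at *
  linear_combination (-2 / 3) * h1
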